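/- Let V satisfy the standing assumptions and λ > 0. Let h : [0,T] × ℝ^d → ℝ be continuous, C¹ in time and C² in space on (0,T] × ℝ^d, solving ∂ₜh = Δh + λV(∇h) pointwise on (0,T] × ℝ^d with h(0,·) = h₀, and such that for every x ∈ ℝ^d, sup_{t∈[0,T]} (e^{2λ|h(t,·)|})*(x) < ∞. Then for every a ≥ 1, every t ∈ [0,T] and every x ∈ ℝ^d, (e^{aλ|h(t,·)|})*(x) ≤ (e^{aλ|h₀|})*(x) (an inequality in [0,∞]); in particular |h(t,x)| ≤ (1/λ)·ln( (e^{λ|h₀|})*(x) ). -/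

import Mathlib

open MeasureTheory Real Set
open scoped ENNReal

noncomputable section

/-- The Laplacian of a function `f : ℝ^d → ℝ` at `x`, as the trace of the second derivative. -/
def lapl {d : ℕ} (f : EuclideanSpace ℝ (Fin d) → ℝ) (x : EuclideanSpace ℝ (Fin d)) : ℝ :=
  ∑ i : Fin d,
    iteratedFDeriv ℝ 2 f x ![EuclideanSpace.single i (1:ℝ), EuclideanSpace.single i (1:ℝ)]

/-- Standing assumptions on the deposition rate `V` (with radial profile `W`):
`V` is `C²`, isotropic, convex, `W 0 = 0`, `W ≥ 0` and `W y ≤ y²` on `[0,∞)`. -/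
structure IsDepositionRate (d : ℕ) (V : EuclideanSpace ℝ (Fin d) → ℝ) (W : ℝ → ℝ) : Prop where
  smooth : ContDiff ℝ 2 V
  isotropic : ∀ p, V p = W ‖p‖
  convex : ConvexOn ℝ Set.univ V
  zero : W 0 = 0
  nonneg : ∀ y : ℝ, 0 ≤ y → 0 ≤ W y
  quadGrowth : ∀ y : ℝ, 0 ≤ y → W y ≤ y ^ 2

/-- The pointwise maximal heat quantity
`f*(x) = sup_{τ>0} ∫ (2πτ)^{-d/2} e^{-|x-y|²/(2τ)} |f(y)| dy ∈ [0,∞]`. -/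
def fstar {d : ℕ} (f : EuclideanSpace ℝ (Fin d) → ℝ)
    (x : EuclideanSpace ℝ (Fin d)) : ℝ≥0∞ :=
  ⨆ τ ∈ Set.Ioi (0:ℝ),
    ∫⁻ y, ENNReal.ofReal ((2 * π * τ) ^ (-(d:ℝ)/2) * Real.exp (-‖x - y‖^2 / (2 * τ)) * |f y|)


abbrev EE (d : ℕ) := EuclideanSpace ℝ (Fin d)

def gk {d : ℕ} (τ : ℝ) (z : EE d) : ℝ :=
  (2 * π * τ) ^ (-(d:ℝ)/2) * Real.exp (-‖z‖^2 / (2 * τ))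

lemma gk_pos {d : ℕ} {τ : ℝ} (hτ : 0 < τ) (z : EE d) : 0 < gk τ z := by
  unfold gk; positivity

lemma gk_cont {d : ℕ} (τ : ℝ) : Continuous (fun z : EE d => gk τ z) := by
  unfold gk; fun_prop

lemma gk_neg {d : ℕ} (τ : ℝ) (z : EE d) : gk τ (-z) = gk τ z := by
  simp [gk]

lemma gk_sub_comm {d : ℕ} (τ : ℝ) (z y : EE d) : gk τ (z - y) = gk τ (y - z) := by
  rw [← gk_neg, neg_sub]

lemma gk_integrable {d : ℕ} {τ : ℝ} (hτ : 0 < τ) : Integrable (fun z : EE d => gk τ z) := by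
  unfold gk
  apply Integrable.const_mul
  have := GaussianFourier.integrable_cexp_neg_mul_sq_norm_add (b := ((1/(2*τ) : ℝ) : ℂ))
    (by rw [Complex.ofReal_re]; positivity) 0 (0 : EE d)
  have h2 := this.norm
  refine h2.congr (Filter.Eventually.of_forall fun z => ?_)
  simp only [Complex.norm_exp]
  congr 1
  simp only [zero_mul, add_zero]
  rw [← Complex.ofReal_pow, ← Complex.ofReal_neg, ← Complex.ofReal_mul, Complex.ofReal_re]
  field_simp

lemma gk_integral {d : ℕ} {τ : ℝ} (hτ : 0 < τ) : ∫ z : EE d, gk τ z = 1 := by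
  unfold gk
  rw [integral_const_mul]
  have := GaussianFourier.integral_rexp_neg_mul_sq_norm (V := EE d) (b := 1/(2*τ)) (by positivity)
  have e : (fun z : EE d => rexp (-‖z‖^2 / (2 * τ))) = fun z => rexp (-(1/(2*τ)) * ‖z‖^2) := by
    funext z; congr 1; field_simp
  rw [e, this, show π / (1 / (2*τ)) = 2 * π * τ by field_simp]
  simp only [finrank_euclideanSpace, Fintype.card_fin]
  rw [← Real.rpow_add (by positivity)]
  rw [show -(d:ℝ)/2 + d/2 = 0 by ring, Real.rpow_zero]

lemma gk_integrable_sub {d : ℕ} {τ : ℝ} (hτ : 0 < τ) (x : EE d) :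
    Integrable (fun z : EE d => gk τ (x - z)) := (gk_integrable hτ).comp_sub_left x

lemma gk_integral_sub {d : ℕ} {τ : ℝ} (hτ : 0 < τ) (x : EE d) :
    ∫ z : EE d, gk τ (x - z) = 1 := by
  rw [integral_sub_left_eq_self (fun z => gk τ z) volume x, gk_integral hτ]

lemma gk_integrable_sub' {d : ℕ} {τ : ℝ} (hτ : 0 < τ) (x : EE d) :
    Integrable (fun z : EE d => gk τ (z - x)) := (gk_integrable hτ).comp_sub_right x

lemma gk_integral_sub' {d : ℕ} {τ : ℝ} (hτ : 0 < τ) (x : EE d) :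
    ∫ z : EE d, gk τ (z - x) = 1 := by
  rw [integral_sub_right_eq_self (fun z => gk τ z) x, gk_integral hτ]

lemma gk_prod {d : ℕ} {a b : ℝ} (ha : 0 < a) (hb : 0 < b) (x y z : EE d) :
    gk a (y - z) * gk b (x - y) =
      gk (a+b) (x - z) * gk (a*b/(a+b)) (y - (z + (a/(a+b)) • (x - z))) := by
  unfold gk
  rw [mul_mul_mul_comm, mul_mul_mul_comm ((2 * π * (a+b)) ^ (-(d:ℝ)/2))]
  have hab : 0 < a + b := by positivity
  congr 1
  · rw [← Real.mul_rpow (by positivity) (by positivity), ← Real.mul_rpow (by positivity) (by positivity)]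
    congr 1; field_simp
  · rw [← Real.exp_add, ← Real.exp_add]
    congr 1
    have h1 : x - y = (x - z) - (y - z) := by abel
    have h2 : y - (z + (a/(a+b)) • (x - z)) = (y - z) - (a/(a+b)) • (x - z) := by abel
    rw [h1, h2]
    generalize x - z = p
    generalize y - z = q
    rw [norm_sub_sq_real, norm_sub_sq_real, real_inner_smul_right, norm_smul, mul_pow, real_inner_comm]
    simp only [norm_eq_abs, sq_abs]
    field_simp
    ring

lemma gk_scale {d : ℕ} {v : ℝ} (hv : 0 < v) (ξ : EE d) :
    gk v ((√v) • ξ) = ((√v)^d)⁻¹ * gk 1 ξ := by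
  unfold gk
  rw [norm_smul, mul_pow]
  simp only [norm_eq_abs, sq_abs, Real.sq_sqrt hv.le, mul_one]
  rw [← mul_assoc]
  congr 1
  · rw [Real.mul_rpow (by positivity) hv.le, mul_comm]
    congr 1
    rw [← Real.rpow_natCast, ← Real.rpow_neg (by positivity), Real.sqrt_eq_rpow, ← Real.rpow_mul hv.le]
    congr 1; ring
  · congr 1; field_simp

lemma gk_cov {d : ℕ} {v : ℝ} (hv : 0 < v) (m : EE d) (F : EE d → ℝ) :
    ∫ y, gk v (y - m) * F y = ∫ ξ, gk 1 ξ * F (m + (√v) • ξ) := by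
  have h1 : ∫ y, gk v (y - m) * F y = ∫ y, gk v y * F (m + y) := by
    rw [← integral_add_left_eq_self (fun y => gk v (y - m) * F y) m]
    simp
  have h2 := Measure.integral_comp_smul (volume : Measure (EE d)) (fun y => gk v y * F (m + y)) (√v)
  simp only [gk_scale hv, finrank_euclideanSpace, Fintype.card_fin, smul_eq_mul, mul_assoc] at h2
  rw [integral_const_mul, abs_of_pos (by positivity)] at h2
  rw [h1]
  exact (mul_left_cancel₀ (by positivity) h2).symm

lemma gk_poly {d : ℕ} {τ : ℝ} (hτ : 0 < τ) (z : EE d) :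
    (1 + ‖z‖^4) * gk τ z ≤ (2:ℝ)^((d:ℝ)/2) * (1 + 32*τ^2) * gk (2*τ) z := by
  unfold gk
  have e1 : (2 * π * τ) ^ (-(d:ℝ)/2) = (2:ℝ)^((d:ℝ)/2) * (2*π*(2*τ)) ^ (-(d:ℝ)/2) := by
    rw [show 2*π*(2*τ) = 2 * (2*π*τ) by ring, Real.mul_rpow (x := 2) (y := 2*π*τ) (by positivity) (by positivity),
      ← mul_assoc, ← Real.rpow_add (by positivity)]
    rw [show (d:ℝ)/2 + -(d:ℝ)/2 = 0 by ring]; simp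
  rw [e1]
  have key : (1 + ‖z‖^4) * rexp (-‖z‖^2/(2*τ)) ≤ (1 + 32*τ^2) * rexp (-‖z‖^2/(2*(2*τ))) := by
    set s := ‖z‖^2/(4*τ) with hs
    have hs0 : 0 ≤ s := by positivity
    have e2 : -‖z‖^2/(2*τ) = -s + -s := by rw [hs]; field_simp; ring
    have e3 : -‖z‖^2/(2*(2*τ)) = -s := by rw [hs]; field_simp; ring
    have e4 : ‖z‖^4 = 16*τ^2*s^2 := by rw [hs]; field_simp; ring
    rw [e2, e3, e4, Real.exp_add, ← mul_assoc]
    apply mul_le_mul_of_nonneg_right _ (by positivity)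
    rw [Real.exp_neg]
    rw [← div_eq_mul_inv, div_le_iff₀ (by positivity)]
    have := Real.quadratic_le_exp_of_nonneg hs0
    have h1 : 1 ≤ rexp s := Real.one_le_exp hs0
    have h2 : s^2 ≤ 2 * rexp s := by nlinarith
    nlinarith [mul_le_mul_of_nonneg_left h2 (show 0 ≤ 16*τ^2 by positivity)]
  calc _ = ((2:ℝ)^((d:ℝ)/2) * (2*π*(2*τ)) ^ (-(d:ℝ)/2)) * ((1 + ‖z‖^4) * rexp (-‖z‖^2/(2*τ))) := by ring
    _ ≤ ((2:ℝ)^((d:ℝ)/2) * (2*π*(2*τ)) ^ (-(d:ℝ)/2)) * ((1 + 32*τ^2) * rexp (-‖z‖^2/(2*(2*τ)))) := by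
        gcongr
    _ = _ := by ring

lemma gk_poly_integrable {d : ℕ} : Integrable (fun z : EE d => (1 + ‖z‖^4) * gk 1 z) := by
  refine Integrable.mono' (((gk_integrable (d := d) (τ := 2*1) (by norm_num))).const_mul
    ((2:ℝ)^((d:ℝ)/2) * (1 + 32*1^2))) ?_ ?_
  · have := gk_cont (d := d) 1
    exact (by fun_prop : Continuous (fun z : EE d => (1 + ‖z‖^4) * gk 1 z)).aestronglyMeasurable
  · refine Filter.Eventually.of_forall fun z => ?_
    have := gk_poly (d := d) (τ := 1) one_pos z
    rw [Real.norm_of_nonneg (mul_nonneg (by positivity) (gk_pos one_pos z).le)]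
    exact this


def HD {d : ℕ} (φ : ℝ → EE d → ℝ) (t : ℝ) (x : EE d) (a D : ℝ) : Prop :=
  HasDerivAt (fun s => φ s x) a t ∧ ∃ (D1 : Fin d → ℝ → ℝ) (D2 : Fin d → ℝ),
    (∀ i s, HasDerivAt (fun s => φ t (x + s • EuclideanSpace.single i (1:ℝ))) (D1 i s) s) ∧
    (∀ i, HasDerivAt (D1 i) (D2 i) 0) ∧ D = ∑ i, D2 i

lemma HD.sub {d : ℕ} {φ ψ : ℝ → EE d → ℝ} {t : ℝ} {x : EE d} {a D b D' : ℝ}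
    (h1 : HD φ t x a D) (h2 : HD ψ t x b D') : HD (fun s y => φ s y - ψ s y) t x (a - b) (D - D') := by
  obtain ⟨h1a, A1, A2, h1b, h1c, rfl⟩ := h1
  obtain ⟨h2a, B1, B2, h2b, h2c, rfl⟩ := h2
  refine ⟨h1a.sub h2a, fun i s => A1 i s - B1 i s, fun i => A2 i - B2 i, fun i s => (h1b i s).sub (h2b i s),
    fun i => (h1c i).sub (h2c i), by rw [Finset.sum_sub_distrib]⟩

lemma HD.const_mul {d : ℕ} {φ : ℝ → EE d → ℝ} {t : ℝ} {x : EE d} {a D : ℝ} (c : ℝ)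
    (h1 : HD φ t x a D) : HD (fun s y => c * φ s y) t x (c * a) (c * D) := by
  obtain ⟨h1a, A1, A2, h1b, h1c, rfl⟩ := h1
  refine ⟨h1a.const_mul c, fun i s => c * A1 i s, fun i => c * A2 i, fun i s => (h1b i s).const_mul c,
    fun i => (h1c i).const_mul c, by rw [Finset.mul_sum]⟩

lemma HD.shift {d : ℕ} {φ : ℝ → EE d → ℝ} {t s : ℝ} {x : EE d} {a D : ℝ}
    (h1 : HD φ (t - s) x a D) : HD (fun r y => φ (r - s) y) t x a D := by
  obtain ⟨h1a, A1, A2, h1b, h1c, rfl⟩ := h1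
  exact ⟨HasDerivAt.comp_sub_const (f := fun s => φ s x) t s h1a, A1, A2, h1b, h1c, rfl⟩

lemma second_deriv_nonpos {ψ D1 : ℝ → ℝ} {D2 : ℝ} (h1 : ∀ s, HasDerivAt ψ (D1 s) s)
    (h2 : HasDerivAt D1 D2 0) (hm : IsLocalMax ψ 0) : D2 ≤ 0 := by
  by_contra hc
  push Not at hc
  have e1 : deriv ψ = D1 := funext fun s => (h1 s).deriv
  have hmin : IsLocalMin ψ 0 := by
    apply isLocalMin_of_deriv_deriv_pos
    · rw [e1, h2.deriv]; exact hc
    · exact hm.deriv_eq_zero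
    · exact (h1 0).continuousAt
  have hconst : ψ =ᶠ[nhds 0] fun _ => ψ 0 := by
    filter_upwards [hm, hmin] with s a b using le_antisymm a b
  have e2 : deriv ψ =ᶠ[nhds 0] deriv (fun _ => ψ 0) := hconst.deriv
  have e3 := e2.deriv_eq
  rw [e1, h2.deriv] at e3
  simp at e3
  linarith

lemma HD.max_time {d : ℕ} {φ : ℝ → EE d → ℝ} {t s : ℝ} {x : EE d} {a D : ℝ}
    (h1 : HD φ t x a D) (hst : s < t) (hm : ∀ r ∈ Icc s t, φ r x ≤ φ t x) : 0 ≤ a := by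
  have h := hasDerivAt_iff_tendsto_slope.1 h1.1
  have h' := h.mono_left (nhdsWithin_mono t (s := Iio t) (fun r hr => ne_of_lt hr))
  refine ge_of_tendsto h' ?_
  filter_upwards [Ioo_mem_nhdsLT hst] with r hr
  rw [slope_def_field]
  have := hm r ⟨hr.1.le, hr.2.le⟩
  exact div_nonneg_of_nonpos (by linarith) (by linarith [hr.2])

lemma HD.max_space {d : ℕ} {φ : ℝ → EE d → ℝ} {t : ℝ} {x : EE d} {a D : ℝ}
    (h1 : HD φ t x a D) (hm : ∀ᶠ y in nhds x, φ t y ≤ φ t x) : D ≤ 0 := by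
  obtain ⟨-, A1, A2, h1b, h1c, rfl⟩ := h1
  apply Finset.sum_nonpos
  intro i _
  refine second_deriv_nonpos (h1b i) (h1c i) ?_
  have hc : Filter.Tendsto (fun s : ℝ => x + s • EuclideanSpace.single i (1:ℝ)) (nhds 0) (nhds x) := by
    have : Continuous (fun s : ℝ => x + s • EuclideanSpace.single i (1:ℝ)) := by fun_prop
    have h0 := this.tendsto 0
    simpa using h0
  have := hc.eventually hm
  simpa [IsLocalMax, IsMaxFilter] using this

lemma param_deriv {d : ℕ} {f : EE d → ℝ} (hf : Continuous f) (hfc : HasCompactSupport f)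
    (K K' : ℝ → EE d → ℝ) (s0 ε : ℝ) (hε : 0 < ε)
    (hK : ∀ s ∈ Icc (s0 - ε) (s0 + ε), Continuous (K s))
    (hK' : ContinuousOn (fun p : ℝ × EE d => K' p.1 p.2) (Icc (s0 - ε) (s0 + ε) ×ˢ univ))
    (hd : ∀ s ∈ Icc (s0 - ε) (s0 + ε), ∀ y, HasDerivAt (fun s => K s y) (K' s y) s) :
    HasDerivAt (fun s => ∫ y, K s y * f y) (∫ y, K' s0 y * f y) s0 := by
  have hcomp : IsCompact (Icc (s0 - ε) (s0 + ε) ×ˢ tsupport f) := isCompact_Icc.prod hfc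
  obtain ⟨C, hC⟩ := hcomp.exists_bound_of_continuousOn (hK'.mono (by gcongr; exact subset_univ _))
  have hs : Icc (s0 - ε) (s0 + ε) ∈ nhds s0 := Icc_mem_nhds (by linarith) (by linarith)
  have h0 : s0 ∈ Icc (s0 - ε) (s0 + ε) := ⟨by linarith, by linarith⟩
  have hK'0 : Continuous (K' s0) := by
    have : ContinuousOn (fun y : EE d => (s0, y)) univ := by fun_prop
    have := hK'.comp this (fun y _ => ⟨h0, mem_univ _⟩)
    exact continuousOn_univ.1 this
  refine (hasDerivAt_integral_of_dominated_loc_of_deriv_le (bound := fun y => C * ‖f y‖) (F' := fun s y => K' s y * f y) hs ?_ ?_ ?_ ?_ ?_ ?_).2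
  · filter_upwards [hs] with s hs
    exact ((hK s hs).mul hf).aestronglyMeasurable
  · exact ((hK s0 h0).mul hf).integrable_of_hasCompactSupport hfc.mul_left
  · exact (hK'0.mul hf).aestronglyMeasurable
  · refine Filter.Eventually.of_forall fun y s hs => ?_
    rw [norm_mul]
    by_cases hy : y ∈ tsupport f
    · gcongr
      exact hC (s, y) ⟨hs, hy⟩
    · rw [image_eq_zero_of_notMem_tsupport hy]; simp
  · exact (hf.integrable_of_hasCompactSupport hfc).norm.const_mul C
  · exact Filter.Eventually.of_forall fun y s hs => (hd s hs y).mul_const _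

def wk {d : ℕ} (f : EE d → ℝ) (r : ℝ) (x : EE d) : ℝ := ∫ y, gk 1 y * f (x + √(2*r) • y)

lemma wk_cont {d : ℕ} {f : EE d → ℝ} (hf : Continuous f) (hfc : HasCompactSupport f) :
    Continuous (fun p : ℝ × EE d => wk f p.1 p.2) := by
  obtain ⟨C, hC⟩ := hfc.exists_bound_of_continuous hf
  unfold wk
  refine continuous_of_dominated (bound := fun y => gk 1 y * C) ?_ ?_ ?_ ?_
  · intro p
    have := gk_cont (d := d) 1
    exact (by fun_prop : Continuous _).aestronglyMeasurable
  · intro p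
    refine Filter.Eventually.of_forall fun y => ?_
    rw [norm_mul, Real.norm_of_nonneg (gk_pos one_pos y).le]
    have := (gk_pos one_pos y).le
    gcongr
    exact hC _
  · exact (gk_integrable one_pos).mul_const C
  · refine Filter.Eventually.of_forall fun y => ?_
    fun_prop

lemma wk_zero {d : ℕ} {f : EE d → ℝ} (x : EE d) : wk f 0 x = f x := by
  unfold wk
  simp only [mul_zero, Real.sqrt_zero, zero_smul, add_zero]
  rw [integral_mul_const, gk_integral one_pos, one_mul]

lemma wk_eq {d : ℕ} {f : EE d → ℝ} {r : ℝ} (hr : 0 < r) (x : EE d) :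
    wk f r x = ∫ y, gk (2*r) (y - x) * f y := by
  rw [gk_cov (by positivity)]; rfl

lemma gk_dt {d : ℕ} {r : ℝ} (hr : 0 < r) (z : EE d) :
    HasDerivAt (fun s => gk (2*s) z) ((‖z‖^2/(4*r^2) - d/(2*r)) * gk (2*r) z) r := by
  unfold gk
  have h1 : HasDerivAt (fun s : ℝ => (2*π*(2*s))) (2*π*(2*1)) r :=
    ((hasDerivAt_id r).const_mul 2).const_mul (2*π)
  have h2 := h1.rpow_const (p := -(d:ℝ)/2) (Or.inl (by positivity))
  have h3 : HasDerivAt (fun s : ℝ => -‖z‖^2/(2*(2*s))) (‖z‖^2/(4*r^2)) r := by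
    have := ((hasDerivAt_inv hr.ne').const_mul (-‖z‖^2/4))
    refine (this.congr_deriv ?_).congr_of_eventuallyEq ?_
    · field_simp
    · filter_upwards with s
      by_cases hs : s = 0
      · simp [hs]
      · field_simp; norm_num
  refine (h2.mul h3.exp).congr_deriv ?_
  rw [Real.rpow_sub_one (by positivity)]
  field_simp
  ring

lemma norm_sub_single {d : ℕ} (p : EE d) (i : Fin d) (s : ℝ) :
    ‖p - s • EuclideanSpace.single i (1:ℝ)‖^2 = ‖p‖^2 - 2 * s * p i + s^2 := by
  rw [norm_sub_sq_real, real_inner_smul_right, norm_smul]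
  simp [EuclideanSpace.inner_single_right]
  ring

lemma gk_dx1 {d : ℕ} {r : ℝ} (hr : 0 < r) (p : EE d) (i : Fin d) (s : ℝ) :
    HasDerivAt (fun s : ℝ => gk (2*r) (p - s • EuclideanSpace.single i (1:ℝ)))
      ((p i - s)/(2*r) * gk (2*r) (p - s • EuclideanSpace.single i (1:ℝ))) s := by
  unfold gk
  simp only [norm_sub_single]
  have h1 : HasDerivAt (fun s : ℝ => -(‖p‖^2 - 2 * s * p i + s^2)/(2*(2*r))) ((p i - s)/(2*r)) s := by
    have a := (((hasDerivAt_id s).const_mul 2).mul_const (p i)).const_sub (‖p‖^2)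
    have b := ((a.add (hasDerivAt_pow 2 s)).neg).div_const (2*(2*r))
    refine b.congr_deriv ?_
    field_simp; ring
  refine (h1.exp.const_mul _).congr_deriv ?_
  ring

lemma gk_dx2 {d : ℕ} {r : ℝ} (hr : 0 < r) (p : EE d) (i : Fin d) (s : ℝ) :
    HasDerivAt (fun s : ℝ => (p i - s)/(2*r) * gk (2*r) (p - s • EuclideanSpace.single i (1:ℝ)))
      ((((p i - s)/(2*r))^2 - 1/(2*r)) * gk (2*r) (p - s • EuclideanSpace.single i (1:ℝ))) s := by
  have h1 : HasDerivAt (fun s : ℝ => (p i - s)/(2*r)) (-1/(2*r)) s :=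
    ((hasDerivAt_id s).const_sub (p i)).div_const (2*r)
  refine (h1.mul (gk_dx1 hr p i s)).congr_deriv ?_
  ring

lemma gk_cont2 {d : ℕ} : ContinuousOn (fun p : ℝ × EE d => gk (2*p.1) p.2) (Ioi 0 ×ˢ univ) := by
  unfold gk
  have h1 : ContinuousOn (fun p : ℝ × EE d => (2*π*(2*p.1)) ^ (-(d:ℝ)/2)) (Ioi 0 ×ˢ univ) := by
    apply ContinuousOn.rpow_const (by fun_prop)
    rintro ⟨r, y⟩ ⟨hr, -⟩
    left
    have : 0 < r := hr
    positivity
  apply h1.mul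
  apply ContinuousOn.rexp
  apply ContinuousOn.div (by fun_prop) (by fun_prop)
  rintro ⟨r, y⟩ ⟨hr, -⟩
  have : 0 < r := hr
  positivity

lemma wk_HD {d : ℕ} {f : EE d → ℝ} (hf : Continuous f) (hfc : HasCompactSupport f)
    {r : ℝ} (hr : 0 < r) (x : EE d) : ∃ a, HD (wk f) r x a a := by
  have hg := gk_cont (d := d) (2*r)
  refine ⟨∫ y, ((‖y-x‖^2/(4*r^2) - d/(2*r)) * gk (2*r) (y-x)) * f y, ?_,
    fun i s => ∫ y, (((y-x) i - s)/(2*r) * gk (2*r) ((y-x) - s • EuclideanSpace.single i (1:ℝ))) * f y,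
    fun i => ∫ y, ((((y-x) i - 0)/(2*r))^2 - 1/(2*r)) * gk (2*r) ((y-x) - (0:ℝ) • EuclideanSpace.single i (1:ℝ)) * f y, ?_, ?_, ?_⟩
  · have := param_deriv hf hfc (fun s y => gk (2*s) (y-x))
      (fun s y => (‖y-x‖^2/(4*s^2) - d/(2*s)) * gk (2*s) (y-x)) r (r/2) (by positivity) ?_ ?_ ?_
    · refine this.congr_of_eventuallyEq ?_
      filter_upwards [lt_mem_nhds hr] with s hs
      exact wk_eq hs x
    · intro s _
      exact (gk_cont (2*s)).comp (by fun_prop)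
    · have hpos : ∀ p ∈ (Icc (r - r/2) (r + r/2) ×ˢ (univ : Set (EE d))), 0 < p.1 := by
        rintro ⟨s, y⟩ ⟨⟨h1, h2⟩, -⟩
        simp only at h1 ⊢
        linarith
      apply ContinuousOn.mul
      · apply ContinuousOn.sub
        · apply ContinuousOn.div (by fun_prop) (by fun_prop)
          intro p hp
          have := hpos p hp
          positivity
        · apply ContinuousOn.div (by fun_prop) (by fun_prop)
          intro p hp
          have := hpos p hp
          positivity
      · refine gk_cont2.comp (f := fun p : ℝ × EE d => (p.1, p.2 - x)) (by fun_prop) ?_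
        intro p hp
        exact ⟨hpos p hp, mem_univ _⟩
    · intro s hs y
      exact gk_dt (by linarith [hs.1]) _
  · intro i s
    have := param_deriv hf hfc (fun s y => gk (2*r) ((y-x) - s • EuclideanSpace.single i (1:ℝ)))
      (fun s y => (((y-x) i - s)/(2*r) * gk (2*r) ((y-x) - s • EuclideanSpace.single i (1:ℝ))))
      s 1 one_pos ?_ ?_ ?_
    · refine this.congr_of_eventuallyEq ?_
      filter_upwards with s
      rw [wk_eq hr]
      simp only [sub_sub]
    · intro s _
      exact hg.comp (by fun_prop)
    · apply Continuous.continuousOn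
      apply Continuous.mul
      · fun_prop
      · exact hg.comp (f := fun p : ℝ × EE d => (p.2-x) - p.1 • EuclideanSpace.single i (1:ℝ)) (by fun_prop)
    · intro s _ y
      exact gk_dx1 hr _ i s
  · intro i
    refine param_deriv hf hfc _ (fun s y => ((((y-x) i - s)/(2*r))^2 - 1/(2*r)) * gk (2*r) ((y-x) - s • EuclideanSpace.single i (1:ℝ))) 0 1 one_pos ?_ ?_ ?_
    · intro s _
      apply Continuous.mul
      · fun_prop
      · exact hg.comp (by fun_prop)
    · apply Continuous.continuousOn
      apply Continuous.mul
      · fun_prop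
      · exact hg.comp (f := fun p : ℝ × EE d => (p.2-x) - p.1 • EuclideanSpace.single i (1:ℝ)) (by fun_prop)
    · intro s _ y
      exact gk_dx2 hr _ i s
  · rw [← integral_finsetSum]
    · congr 1
      funext y
      simp only [zero_smul, sub_zero]
      rw [← Finset.sum_mul, ← Finset.sum_mul]
      congr 2
      rw [Finset.sum_sub_distrib, EuclideanSpace.real_norm_sq_eq]
      simp only [div_pow, Finset.sum_const, Finset.card_univ, Fintype.card_fin, nsmul_eq_mul]
      rw [← Finset.sum_div]
      ring
    · intro i _
      apply Continuous.integrable_of_hasCompactSupport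
      · apply Continuous.mul _ hf
        apply Continuous.mul
        · fun_prop
        · exact hg.comp (by fun_prop)
      · exact hfc.mul_left


def bar {d : ℕ} (x0 : EE d) (r : ℝ) (y : EE d) : ℝ :=
  (‖y - x0‖^2)^2 + (4*d+8) * r * ‖y - x0‖^2 + d*(4*d+8) * r^2

lemma norm_add_single {d : ℕ} (p : EE d) (i : Fin d) (s : ℝ) :
    ‖p + s • EuclideanSpace.single i (1:ℝ)‖^2 = ‖p‖^2 + 2 * s * p i + s^2 := by
  have := norm_sub_single p i (-s)
  rw [neg_smul, sub_neg_eq_add] at this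
  rw [this]; ring

lemma bar_HD {d : ℕ} (x0 : EE d) (r : ℝ) (y : EE d) : ∃ a, HD (bar x0) r y a a := by
  refine ⟨(4*d+8) * ‖y - x0‖^2 + d*(4*d+8) * (2*r), ?_,
    fun i s => 2*(‖y-x0‖^2 + 2*s*(y-x0) i + s^2)*(2*(y-x0) i + 2*s) + (4*d+8)*r*(2*(y-x0) i + 2*s),
    fun i => 2*((2*(y-x0) i)*(2*(y-x0) i) + ‖y-x0‖^2*2) + (4*d+8)*r*2, ?_, ?_, ?_⟩
  · unfold bar
    have h1 : HasDerivAt (fun r : ℝ => (4*(d:ℝ)+8) * r * ‖y - x0‖^2) ((4*d+8) * ‖y - x0‖^2) r := by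
      have := ((hasDerivAt_id r).const_mul (4*(d:ℝ)+8)).mul_const (‖y - x0‖^2)
      exact this.congr_deriv (by ring)
    have h2 : HasDerivAt (fun r : ℝ => (d*(4*(d:ℝ)+8)) * r^2) (d*(4*d+8) * (2*r)) r := by
      have := (hasDerivAt_pow 2 r).const_mul (d*(4*(d:ℝ)+8))
      exact this.congr_deriv (by ring)
    exact (h1.const_add _).add h2
  · intro i s
    unfold bar
    have e : ∀ s : ℝ, ‖y + s • EuclideanSpace.single i (1:ℝ) - x0‖^2 = ‖y-x0‖^2 + 2*s*(y-x0) i + s^2 := by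
      intro s
      rw [← norm_add_single]; congr 2; abel
    simp only [e]
    have a : HasDerivAt (fun s : ℝ => ‖y-x0‖^2 + 2*s*(y-x0) i + s^2) (2*(y-x0) i + 2*s) s := by
      have a := (((hasDerivAt_id s).const_mul 2).mul_const ((y-x0) i)).const_add (‖y-x0‖^2)
      exact (a.add (hasDerivAt_pow 2 s)).congr_deriv (by ring)
    exact (((a.pow 2).add (a.const_mul ((4*d+8)*r))).add_const _).congr_deriv (by ring)
  · intro i
    have a : HasDerivAt (fun s : ℝ => ‖y-x0‖^2 + 2*s*(y-x0) i + s^2) (2*(y-x0) i + 2*0) 0 := by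
      have a := (((hasDerivAt_id (0:ℝ)).const_mul 2).mul_const ((y-x0) i)).const_add (‖y-x0‖^2)
      exact (a.add (hasDerivAt_pow 2 0)).congr_deriv (by ring)
    have b : HasDerivAt (fun s : ℝ => (2*(y-x0) i + 2*s)) 2 0 := by
      have := ((hasDerivAt_id (0:ℝ)).const_mul 2).const_add (2*(y-x0) i)
      exact this.congr_deriv (by ring)
    refine (((a.const_mul 2).mul b).add (b.const_mul ((4*d+8)*r))).congr_deriv (by ring)
  · rw [Finset.sum_add_distrib, ← Finset.mul_sum, Finset.sum_add_distrib]
    have : ∑ i : Fin d, (2*(y-x0) i)*(2*(y-x0) i) = 4 * ‖y-x0‖^2 := by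
      rw [EuclideanSpace.real_norm_sq_eq, Finset.mul_sum]
      exact Finset.sum_congr rfl fun i _ => by ring
    rw [this]
    simp only [Finset.sum_const, Finset.card_univ, Fintype.card_fin, nsmul_eq_mul]
    ring

lemma time_HD {d : ℕ} (r : ℝ) (y : EE d) : HD (fun r (_ : EE d) => r) r y 1 0 :=
  ⟨hasDerivAt_id r, fun _ _ => 0, fun _ => 0, fun _ s => hasDerivAt_const s r,
    fun _ => hasDerivAt_const 0 0, by simp⟩

lemma local_le {d : ℕ} {v : ℝ → EE d → ℝ} {s η M : ℝ} (hη : 0 < η) (x0 : EE d)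
    (hc : ContinuousOn (fun p : ℝ × EE d => v p.1 p.2) (Icc s (s+η) ×ˢ Metric.closedBall x0 1))
    (hsub : ∀ t ∈ Ioc s (s+η), ∀ x, ∃ a D, HD v t x a D ∧ a ≤ D)
    {f : EE d → ℝ} (hf : Continuous f) (hfc : HasCompactSupport f) (hf0 : ∀ y, 0 ≤ f y)
    (hfv : ∀ y ∈ Metric.closedBall x0 1, v s y ≤ f y) (hM0 : 0 ≤ M)
    (hM : ∀ t ∈ Icc s (s+η), ∀ y ∈ Metric.closedBall x0 1, v t y ≤ M) :
    v (s+η) x0 ≤ wk f η x0 + M * (d*(4*d+8) * η^2) := by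
  have main : ∀ ε > 0, v (s+η) x0 ≤ wk f η x0 + M * (d*(4*d+8) * η^2) + ε * η := by
    intro ε hε
    set φ : ℝ → EE d → ℝ := fun t y => v t y - wk f (t - s) y - M * bar x0 (t-s) y - ε * (t-s) with hφ
    have hwnn : ∀ r y, 0 ≤ wk f r y := fun r y =>
      integral_nonneg fun z => mul_nonneg (gk_pos one_pos z).le (hf0 _)
    have hφc : ContinuousOn (fun p : ℝ × EE d => φ p.1 p.2) (Icc s (s+η) ×ˢ Metric.closedBall x0 1) := by
      have hw : Continuous (fun p : ℝ × EE d => wk f (p.1 - s) p.2) :=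
        (wk_cont hf hfc).comp (f := fun p : ℝ × EE d => (p.1 - s, p.2)) (by fun_prop)
      have hb : Continuous (fun p : ℝ × EE d => M * bar x0 (p.1 - s) p.2 ) := by
        unfold bar; fun_prop
      exact ((hc.sub hw.continuousOn).sub hb.continuousOn).sub (by fun_prop)
    have hcomp : IsCompact (Icc s (s+η) ×ˢ Metric.closedBall x0 1) :=
      isCompact_Icc.prod (isCompact_closedBall x0 1)
    have hmem : (s+η, x0) ∈ Icc s (s+η) ×ˢ Metric.closedBall x0 1 :=
      ⟨⟨by linarith, le_rfl⟩, by simp⟩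
    obtain ⟨⟨t, y⟩, ⟨ht, hy⟩, hmax⟩ := hcomp.exists_isMaxOn ⟨_, hmem⟩ hφc
    simp only at ht hy
    have hmax' : ∀ t' ∈ Icc s (s+η), ∀ y' ∈ Metric.closedBall x0 1, φ t' y' ≤ φ t y :=
      fun t' ht' y' hy' => hmax (a := (t', y')) ⟨ht', hy'⟩
    have hle : φ t y ≤ 0 := by
      have hbnn : 0 ≤ bar x0 (t - s) y := by
        have : 0 ≤ t - s := by linarith [ht.1]
        unfold bar; positivity
      rcases eq_or_lt_of_le ht.1 with h | h
      · subst h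
        simp only [hφ, sub_self, wk_zero, mul_zero]
        rw [sub_self] at hbnn
        have := hfv y hy
        have := mul_nonneg hM0 hbnn
        linarith
      · have hr : 0 < t - s := by linarith
        rcases eq_or_lt_of_le (Metric.mem_closedBall.1 hy) with h1 | h1
        · have hb1 : 1 ≤ bar x0 (t - s) y := by
            unfold bar
            rw [← dist_eq_norm, h1]
            have : 0 ≤ (4*(d:ℝ)+8) * (t-s) * 1^2 := by positivity
            have : 0 ≤ d * (4*(d:ℝ)+8) * (t-s)^2 := by positivity
            nlinarith
          have a1 := hM t ht y hy
          have a2 := hwnn (t-s) y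
          have a3 := mul_le_mul_of_nonneg_left hb1 hM0
          have a4 : 0 < ε * (t-s) := by positivity
          simp only [hφ]
          linarith
        · exfalso
          obtain ⟨a, D, hv, haD⟩ := hsub t ⟨h, ht.2⟩ y
          obtain ⟨b, hw⟩ := wk_HD hf hfc hr y
          obtain ⟨c, hb⟩ := bar_HD x0 (t-s) y
          have hH := ((hv.sub hw.shift).sub (hb.shift.const_mul M)).sub
            (((time_HD (t-s) y).shift).const_mul ε)
          have q1 := HD.max_time (φ := φ) hH h (fun r hr => hmax' r ⟨hr.1, hr.2.trans ht.2⟩ y hy)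
          have q2 := HD.max_space (φ := φ) hH (by
            filter_upwards [Metric.isOpen_ball.mem_nhds (Metric.mem_ball.2 h1)] with y' hy'
            exact hmax' t ht y' (Metric.ball_subset_closedBall hy'))
          linarith
    have := hmax' (s+η) hmem.1 x0 hmem.2
    have h2 := this.trans hle
    simp only [hφ, bar, add_sub_cancel_left, sub_self, norm_zero] at h2
    norm_num at h2
    linarith
  refine le_of_forall_pos_le_add fun ε hε => ?_
  have := main (ε/η) (by positivity)
  rwa [div_mul_cancel₀ _ hη.ne'] at this

lemma sub_HD {d : ℕ} {V : EE d → ℝ} {W : ℝ → ℝ} (hV : IsDepositionRate d V W) {lam σ : ℝ}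
    (hlam : 0 < lam) (hσ : σ = 1 ∨ σ = -1) {h : ℝ → EE d → ℝ} {t : ℝ} {x : EE d}
    (hsp : ContDiff ℝ 2 (h t)) (ht : DifferentiableAt ℝ (fun s => h s x) t)
    (hpde : deriv (fun s => h s x) t = lapl (h t) x + lam * V (gradient (h t) x)) :
    ∃ a D, HD (fun t x => rexp (σ * lam * h t x)) t x a D ∧ a ≤ D := by
  set e : Fin d → EE d := fun i => EuclideanSpace.single i (1:ℝ) with he
  have hd1 : ∀ z, HasFDerivAt (h t) (fderiv ℝ (h t) z) z := fun z =>
    (hsp.differentiable (by norm_num) z).hasFDerivAt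
  have hd2 : Differentiable ℝ (fderiv ℝ (h t)) :=
    (hsp.fderiv_right (m := 1) (by norm_num)).differentiable (by norm_num)
  have hline : ∀ i (s : ℝ), HasDerivAt (fun s : ℝ => x + s • e i) (e i) s := by
    intro i s
    have := ((hasDerivAt_id s).smul_const (e i)).const_add x
    simpa using this
  have k1 : ∀ i (s : ℝ), HasDerivAt (fun s : ℝ => h t (x + s • e i)) (fderiv ℝ (h t) (x + s • e i) (e i)) s :=
    fun i s => (hd1 _).comp_hasDerivAt s (hline i s)
  have k2 : ∀ i, HasDerivAt (fun s : ℝ => fderiv ℝ (h t) (x + s • e i) (e i))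
      (fderiv ℝ (fderiv ℝ (h t)) x (e i) (e i)) 0 := by
    intro i
    have := (hd2 (x + (0:ℝ) • e i)).hasFDerivAt.comp_hasDerivAt 0 (hline i 0)
    have h3 := this.clm_apply (hasDerivAt_const (0:ℝ) (e i))
    simpa using h3
  set u := rexp (σ * lam * h t x) with hu
  refine ⟨u * (σ * lam * deriv (fun s => h s x) t),
    ∑ i, (u * (σ * lam * fderiv ℝ (h t) x (e i)) * (σ * lam * fderiv ℝ (h t) x (e i)) +
      u * (σ * lam * fderiv ℝ (fderiv ℝ (h t)) x (e i) (e i))), ⟨?_,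
    fun i s => rexp (σ * lam * h t (x + s • e i)) * (σ * lam * fderiv ℝ (h t) (x + s • e i) (e i)),
    fun i => _, ?_, ?_, rfl⟩, ?_⟩
  · exact (ht.hasDerivAt.const_mul (σ*lam)).exp
  · intro i s
    exact ((k1 i s).const_mul (σ*lam)).exp
  · intro i
    have := (((k1 i 0).const_mul (σ*lam)).exp).mul ((k2 i).const_mul (σ*lam))
    simp only [zero_smul, add_zero] at this
    exact this
  · have hlap : lapl (h t) x = ∑ i, fderiv ℝ (fderiv ℝ (h t)) x (e i) (e i) := by
      unfold lapl
      refine Finset.sum_congr rfl fun i _ => ?_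
      rw [iteratedFDeriv_two_apply]
      rfl
    have hgrad : ‖gradient (h t) x‖^2 = ∑ i, (fderiv ℝ (h t) x (e i))^2 := by
      rw [EuclideanSpace.real_norm_sq_eq]
      refine Finset.sum_congr rfl fun i _ => ?_
      congr 1
      have h1 : inner ℝ (gradient (h t) x) (e i) = fderiv ℝ (h t) x (e i) := by
        unfold gradient
        exact InnerProductSpace.toDual_symm_apply
      rw [← h1, he, EuclideanSpace.inner_single_right]
      simp
    have hs2 : σ * σ = 1 := by rcases hσ with rfl | rfl <;> norm_num
    have hVle : σ * V (gradient (h t) x) ≤ ‖gradient (h t) x‖^2 := by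
      have a1 := hV.nonneg _ (norm_nonneg (gradient (h t) x))
      have a2 := hV.quadGrowth _ (norm_nonneg (gradient (h t) x))
      rw [← hV.isotropic] at a1 a2
      rcases hσ with rfl | rfl
      · linarith
      · nlinarith [sq_nonneg ‖gradient (h t) x‖]
    have hsum : ∑ i, (u * (σ * lam * fderiv ℝ (h t) x (e i)) * (σ * lam * fderiv ℝ (h t) x (e i)) +
      u * (σ * lam * fderiv ℝ (fderiv ℝ (h t)) x (e i) (e i))) =
      u * lam^2 * ‖gradient (h t) x‖^2 + u * (σ * lam) * lapl (h t) x := by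
      rw [hlap, hgrad, Finset.mul_sum, Finset.mul_sum, ← Finset.sum_add_distrib]
      refine Finset.sum_congr rfl fun i _ => ?_
      linear_combination (u * lam^2 * (fderiv ℝ (h t) x (e i))^2) * hs2
    rw [hsum, hpde]
    have hu0 : 0 < u := Real.exp_pos _
    have := mul_le_mul_of_nonneg_left hVle (show 0 ≤ u * lam^2 by positivity)
    nlinarith


lemma pos_sq_ineq (q δ : ℝ) : (max (q+δ) 0)^2 ≤ (max q 0)^2 + 2 * max q 0 * δ + δ^2 := by
  rcases le_total 0 q with h | h <;> rcases le_total 0 (q+δ) with h' | h'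
  · rw [max_eq_left h, max_eq_left h']; nlinarith
  · rw [max_eq_left h, max_eq_right h']; nlinarith [sq_nonneg (q+δ)]
  · rw [max_eq_right h, max_eq_left h']; nlinarith
  · rw [max_eq_right h, max_eq_right h']; nlinarith [sq_nonneg δ]

def chi {d : ℕ} (x : EE d) (R : ℝ) (y : EE d) : ℝ := (max (1 - ‖y - x‖^2/R^2) 0)^2

lemma chi_cont {d : ℕ} (x : EE d) (R : ℝ) : Continuous (chi x R) := by
  unfold chi; fun_prop

lemma chi_nonneg {d : ℕ} (x : EE d) (R : ℝ) (y : EE d) : 0 ≤ chi x R y := sq_nonneg _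

lemma chi_le_one {d : ℕ} (x : EE d) (R : ℝ) (y : EE d) : chi x R y ≤ 1 := by
  unfold chi
  apply pow_le_one₀ (le_max_right _ _)
  apply max_le _ zero_le_one
  have : 0 ≤ ‖y - x‖^2/R^2 := by positivity
  linarith

lemma chi_eq_zero {d : ℕ} {x : EE d} {R : ℝ} (hR : 0 < R) {y : EE d} (hy : y ∉ Metric.closedBall x R) :
    chi x R y = 0 := by
  unfold chi
  rw [max_eq_right, zero_pow two_ne_zero]
  rw [Metric.mem_closedBall, dist_eq_norm, not_le] at hy
  have : 1 ≤ ‖y-x‖^2/R^2 := by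
    rw [one_le_div (by positivity)]; gcongr
  linarith

lemma chi_compact {d : ℕ} (x : EE d) {R : ℝ} (hR : 0 < R) : HasCompactSupport (chi x R) :=
  HasCompactSupport.intro (isCompact_closedBall x R) fun _ hy => chi_eq_zero hR hy

set_option maxHeartbeats 1000000 in
lemma chi_pt {d : ℕ} {τ T0 : ℝ} (hτ : 0 < τ) {a b R : ℝ} (ha : 0 < a) (haT : a ≤ T0)
    (hb : τ ≤ b) (hR : 1 ≤ R) (x z ξ : EE d) :
    chi x R (z + (a/(a+b)) • (x - z) + √(a*b/(a+b)) • ξ) ≤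
      chi x R z + (a/R^2) * ((4/τ + 3*(4/τ+2)) * (1 + ‖x-z‖^4) + 3*(2+T0)*(1+‖ξ‖^4)) -
      (4 * max (1 - ‖z-x‖^2/R^2) 0 * (1 - a/(a+b)) * √(a*b/(a+b)) / R^2) * inner ℝ (z-x) ξ := by
  have hb0 : 0 < b := by linarith
  have hab : 0 < a + b := by positivity
  set θ := a/(a+b) with hθ
  set v := a*b/(a+b) with hv
  have hθ0 : 0 ≤ θ := by positivity
  have hθ1 : θ ≤ 1 := by rw [hθ, div_le_one hab]; linarith
  have hθτ : θ ≤ a/τ := by rw [hθ]; gcongr; linarith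
  have hv0 : 0 ≤ v := by positivity
  have hva : v ≤ a := by
    rw [hv, div_le_iff₀ hab]; nlinarith
  rw [norm_sub_rev x z]
  have hN : ‖z + θ • (x - z) + √v • ξ - x‖^2 =
      (1-θ)^2 * ‖z-x‖^2 + 2*(1-θ)*√v*inner ℝ (z-x) ξ + v * ‖ξ‖^2 := by
    have : z + θ • (x - z) + √v • ξ - x = (1-θ) • (z-x) + √v • ξ := by
      module
    rw [this, norm_add_sq_real, real_inner_smul_left, real_inner_smul_right, norm_smul, norm_smul,
      mul_pow, mul_pow]
    simp only [norm_eq_abs, sq_abs, Real.sq_sqrt hv0]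
    ring
  unfold chi
  rw [hN]
  have hc : (inner ℝ (z-x) ξ)^2 ≤ ‖z-x‖^2 * ‖ξ‖^2 := by
    have := abs_real_inner_le_norm (z-x) ξ
    rw [← mul_pow, ← sq_abs]
    gcongr
  generalize inner ℝ (z-x) ξ = c at *
  have hp : 0 ≤ ‖z-x‖ := norm_nonneg _
  have hk : 0 ≤ ‖ξ‖ := norm_nonneg _
  generalize ‖z-x‖ = p at *
  generalize ‖ξ‖ = k at *
  have hw : (√v)^2 = v := Real.sq_sqrt hv0
  have hw0 : 0 ≤ √v := Real.sqrt_nonneg _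
  generalize √v = w at *
  set Q := (1-θ)^2 * p^2 + 2*(1-θ)*w*c + v * k^2 with hQ
  set δ := (p^2 - Q)/R^2 with hδ
  have e1 : 1 - Q/R^2 = (1 - p^2/R^2) + δ := by rw [hδ]; ring
  rw [e1]
  refine (pos_sq_ineq _ _).trans ?_
  set q := max (1 - p^2/R^2) 0 with hq
  have hq0 : 0 ≤ q := le_max_right _ _
  have hq1 : q ≤ 1 := by
    apply max_le _ zero_le_one
    have : 0 ≤ p^2/R^2 := by positivity
    linarith
  have hR2 : 0 < R^2 := by positivity
  have hR21 : 1 ≤ R^2 := one_le_pow₀ hR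
  -- linear term
  have l1 : 2 * q * δ ≤ (4*θ*p^2)/R^2 - (4*q*(1-θ)*w/R^2)*c := by
    have : 2*q*δ = (2*q*(p^2-Q))/R^2 := by rw [hδ]; ring
    rw [this]
    have e : (4*θ*p^2)/R^2 - (4*q*(1-θ)*w/R^2)*c = (4*θ*p^2 - 4*q*(1-θ)*w*c)/R^2 := by ring
    rw [e]
    gcongr
    have e3 : p^2 - Q = 2*θ*p^2 - θ^2*p^2 - 2*(1-θ)*w*c - v*k^2 := by rw [hQ]; ring
    rw [e3]
    have z1 : 0 ≤ q*(θ^2*p^2) := by positivity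
    have z2 : 0 ≤ q*(v*k^2) := by positivity
    have z3 : 0 ≤ (1-q)*(θ*p^2) := mul_nonneg (by linarith) (by positivity)
    nlinarith
  have hp2 : p^2 ≤ 1 + p^4 := by nlinarith [sq_nonneg (p^2-1), sq_nonneg (p^2)]
  have l2 : 4*θ*p^2 ≤ a * (4/τ*(1+p^4)) := by
    calc 4*θ*p^2 ≤ 4*(a/τ)*(1+p^4) := by gcongr
      _ = _ := by ring
  -- quadratic term
  have l3 : (p^2-Q)^2 ≤ a * (3*(4/τ+2)*(1+p^4) + 3*(2+T0)*(1+k^4)) := by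
    have e3 : p^2 - Q = (2*θ - θ^2)*p^2 + (-(2*(1-θ)*w*c)) + (-(v*k^2)) := by rw [hQ]; ring
    have s1 : ∀ A B C : ℝ, (A+B+C)^2 ≤ 3*(A^2+B^2+C^2) := by
      clear * -
      intro A B C; nlinarith [sq_nonneg (A-B), sq_nonneg (A-C), sq_nonneg (B-C)]
    rw [e3]
    refine (s1 _ _ _).trans ?_
    have t1 : ((2*θ - θ^2)*p^2)^2 ≤ a * (4/τ*(1+p^4)) := by
      have : (2*θ-θ^2)^2 ≤ 4*θ := by
        have i1 : 2*θ-θ^2 ≤ 1 := by linarith [sq_nonneg (θ-1), (by ring : (θ-1)^2 = θ^2-2*θ+1)]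
        have i2 : 0 ≤ 2*θ-θ^2 := by
          have : 2*θ-θ^2 = θ + θ*(1-θ) := by ring
          rw [this]
          have := mul_nonneg hθ0 (show 0 ≤ 1-θ by linarith)
          linarith
        have i3 := mul_le_mul_of_nonneg_left i1 i2
        have i4 := sq_nonneg θ
        have i5 : (2*θ-θ^2)^2 = (2*θ-θ^2)*(2*θ-θ^2) := by ring
        rw [i5]
        linarith
      calc ((2*θ - θ^2)*p^2)^2 = (2*θ-θ^2)^2 * p^4 := by ring
        _ ≤ (4*θ)*(1+p^4) := by gcongr; linarith
        _ ≤ 4*(a/τ)*(1+p^4) := by gcongr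
        _ = _ := by ring
    have t2 : (-(2*(1-θ)*w*c))^2 ≤ a*(2*(1+p^4) + 2*(1+k^4)) := by
      calc (-(2*(1-θ)*w*c))^2 = 4*(1-θ)^2*w^2*c^2 := by ring
        _ = 4*(1-θ)^2*v*c^2 := by rw [hw]
        _ ≤ 4*1*a*(p^2*k^2) := by
            gcongr
            exact pow_le_one₀ (by linarith) (by linarith)
        _ = a*(4*(p^2*k^2)) := by ring
        _ ≤ _ := by
            gcongr
            nlinarith [sq_nonneg (p^2-k^2)]
    have hT00 : 0 ≤ T0 := by linarith
    have t3 : (-(v*k^2))^2 ≤ a*(T0*(1+k^4)) := by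
      calc (-(v*k^2))^2 = v*v*k^4 := by ring
        _ ≤ a*T0*(1+k^4) := by
          gcongr
          · linarith
          · linarith
        _ = _ := by ring
    linarith
  have l4 : δ^2 ≤ (a/R^2) * (3*(4/τ+2)*(1+p^4) + 3*(2+T0)*(1+k^4)) := by
    have : δ^2 = (p^2-Q)^2/(R^2*R^2) := by rw [hδ, div_pow]; ring
    rw [this]
    calc _ ≤ (p^2-Q)^2/(1*R^2) := by gcongr
      _ ≤ (a * (3*(4/τ+2)*(1+p^4) + 3*(2+T0)*(1+k^4)))/(1*R^2) := by gcongr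
      _ = _ := by ring
  have l5 : (4*θ*p^2)/R^2 ≤ (a/R^2) * (4/τ*(1+p^4)) := by
    calc _ ≤ (a * (4/τ*(1+p^4)))/R^2 := by gcongr
      _ = _ := by ring
  have : (a/R^2) * ((4/τ + 3*(4/τ+2)) * (1 + p^4) + 3*(2+T0)*(1+k^4)) =
    (a/R^2) * (4/τ*(1+p^4)) + (a/R^2) * (3*(4/τ+2)*(1+p^4) + 3*(2+T0)*(1+k^4)) := by ring
  linarith

lemma kernel_le {d : ℕ} {τ T0 : ℝ} (hτ : 0 < τ) (hT0 : 0 < T0) : ∃ C : ℝ, 0 ≤ C ∧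
    ∀ a b R : ℝ, 0 < a → a ≤ T0 → τ ≤ b → 1 ≤ R → ∀ x z : EE d,
    ∫ y, gk a (y-z) * gk b (x-y) * chi x R y ≤
      gk (a+b) (x-z) * (chi x R z + C * (a/R^2) * (1 + ‖x-z‖^4)) := by
  set K := ∫ ξ : EE d, (1+‖ξ‖^4) * gk 1 ξ with hK
  have hK0 : 0 ≤ K := integral_nonneg fun z => mul_nonneg (by positivity) (gk_pos one_pos z).le
  refine ⟨(4/τ + 3*(4/τ+2)) + 3*(2+T0)*K, by positivity, ?_⟩
  intro a b R ha haT hb hR x z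
  have hb0 : 0 < b := by linarith
  simp only [gk_prod ha hb0, mul_assoc]
  rw [integral_const_mul]
  have hg0 := gk_pos (show 0 < a+b by positivity) (x-z)
  apply mul_le_mul_of_nonneg_left _ hg0.le
  rw [gk_cov (by positivity)]
  set k := (4 * max (1 - ‖z-x‖^2/R^2) 0 * (1 - a/(a+b)) * √(a*b/(a+b)) / R^2) with hk
  set A := (4/τ + 3*(4/τ+2)) * (1 + ‖x-z‖^4) with hA
  have i1 : Integrable (fun ξ : EE d => gk 1 ξ * inner ℝ (z-x) ξ) := by
    refine Integrable.mono' ((gk_poly_integrable (d := d)).mul_const ‖z-x‖) ?_ ?_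
    · have := gk_cont (d := d) 1
      exact (by fun_prop : Continuous _).aestronglyMeasurable
    · refine Filter.Eventually.of_forall fun ξ => ?_
      rw [norm_mul, Real.norm_of_nonneg (gk_pos one_pos ξ).le]
      have h1 : ‖inner ℝ (z-x) ξ‖ ≤ ‖z-x‖ * (1+‖ξ‖^4) := by
        refine (norm_inner_le_norm _ _).trans ?_
        gcongr
        have := norm_nonneg ξ
        nlinarith [sq_nonneg (‖ξ‖^2-1), sq_nonneg (‖ξ‖-1), sq_nonneg (‖ξ‖^2)]
      have := (gk_pos one_pos ξ).le
      calc _ ≤ gk 1 ξ * (‖z-x‖ * (1+‖ξ‖^4)) := by gcongr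
        _ = _ := by ring
  have o1 : ∫ ξ : EE d, gk 1 ξ * inner ℝ (z-x) ξ = 0 := by
    have := integral_neg_eq_self (fun ξ : EE d => gk 1 ξ * inner ℝ (z-x) ξ) volume
    simp only [gk_neg, inner_neg_right, mul_neg, integral_neg] at this
    linarith
  have i2 : Integrable (fun ξ : EE d => (chi x R z + (a/R^2)*A) * gk 1 ξ) := (gk_integrable one_pos).const_mul _
  have i3 : Integrable (fun ξ : EE d => ((a/R^2)*(3*(2+T0))) * ((1+‖ξ‖^4) * gk 1 ξ)) :=
    gk_poly_integrable.const_mul _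
  have i4 : Integrable (fun ξ : EE d => k * (gk 1 ξ * inner ℝ (z-x) ξ)) := i1.const_mul k
  calc ∫ ξ, gk 1 ξ * chi x R (z + (a/(a+b)) • (x - z) + √(a*b/(a+b)) • ξ)
      ≤ ∫ ξ, ((chi x R z + (a/R^2)*A) * gk 1 ξ + ((a/R^2)*(3*(2+T0))) * ((1+‖ξ‖^4) * gk 1 ξ)) -
          k * (gk 1 ξ * inner ℝ (z-x) ξ) := by
        apply integral_mono_of_nonneg
        · exact Filter.Eventually.of_forall fun ξ => mul_nonneg (gk_pos one_pos ξ).le (chi_nonneg _ _ _)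
        · exact (i2.add i3).sub i4
        · refine Filter.Eventually.of_forall fun ξ => ?_
          have h1 := mul_le_mul_of_nonneg_left (chi_pt hτ ha haT hb hR x z ξ) (gk_pos one_pos ξ).le
          refine h1.trans (le_of_eq ?_)
          simp only [hk, hA]
          ring
    _ = (chi x R z + (a/R^2)*A) + (a/R^2)*(3*(2+T0)) * K := by
        have s1 := integral_sub (i2.add i3) i4
        have s2 := integral_add i2 i3
        simp only [Pi.add_apply] at s1
        rw [s1, s2, integral_const_mul, integral_const_mul, integral_const_mul, o1, gk_integral one_pos, hK]
        ring
    _ ≤ _ := by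
        have : (a/R^2)*(3*(2+T0)) * K * 1 ≤ (a/R^2)*(3*(2+T0)) * K * (1+‖x-z‖^4) := by
          gcongr
          have : 0 ≤ ‖x-z‖^4 := by positivity
          linarith
        rw [hA]
        linarith


structure SubSol {d : ℕ} (T c : ℝ) (u : ℝ → EE d → ℝ) : Prop where
  cont : ContinuousOn (fun p : ℝ × EE d => u p.1 p.2) (Icc 0 T ×ˢ univ)
  nonneg : ∀ t y, 0 ≤ u t y
  loc : ∀ s η : ℝ, 0 ≤ s → 0 < η → s + η ≤ T → ∀ (x0 : EE d) (f : EE d → ℝ), Continuous f →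
    HasCompactSupport f → (∀ y, 0 ≤ f y) → (∀ y ∈ Metric.closedBall x0 1, u s y ≤ f y) →
    ∀ M : ℝ, 0 ≤ M → (∀ t ∈ Icc s (s+η), ∀ y ∈ Metric.closedBall x0 1, u t y ≤ M) →
    u (s+η) x0 ≤ wk f η x0 + M * (c * η^2)
  int : ∀ x : EE d, ∃ C : ℝ, 0 ≤ C ∧ ∀ t ∈ Icc 0 T, ∀ τ : ℝ, 0 < τ →
    Integrable (fun y => gk τ (x-y) * u t y) ∧ ∫ y, gk τ (x-y) * u t y ≤ C

lemma SubSol.cont_t {d : ℕ} {T c : ℝ} {u : ℝ → EE d → ℝ} (hu : SubSol T c u) {t : ℝ} (ht : t ∈ Icc 0 T) :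
    Continuous (u t) := by
  have : ContinuousOn (fun y : EE d => (t, y)) univ := by fun_prop
  have := hu.cont.comp this (fun y _ => ⟨ht, mem_univ _⟩)
  exact continuousOn_univ.1 this

lemma SubSol.bdd {d : ℕ} {T c : ℝ} {u : ℝ → EE d → ℝ} (hu : SubSol T c u) (x : EE d) (R : ℝ) :
    ∃ M : ℝ, 0 ≤ M ∧ ∀ t ∈ Icc 0 T, ∀ y ∈ Metric.closedBall x R, u t y ≤ M := by
  obtain ⟨M, hM⟩ := (isCompact_Icc.prod (isCompact_closedBall x R)).exists_bound_of_continuousOn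
    (hu.cont.mono (by gcongr; exact subset_univ _))
  refine ⟨max M 0, le_max_right _ _, fun t ht y hy => ?_⟩
  exact ((le_abs_self _).trans (hM (t, y) ⟨ht, hy⟩)).trans (le_max_left _ _)

def cut {d : ℕ} (x : EE d) (R : ℝ) (y : EE d) : ℝ := max 0 (min 1 (R + 1 - ‖y - x‖))

lemma cut_cont {d : ℕ} (x : EE d) (R : ℝ) : Continuous (cut x R) := by unfold cut; fun_prop
lemma cut_nonneg {d : ℕ} (x : EE d) (R : ℝ) (y) : 0 ≤ cut x R y := le_max_left _ _
lemma cut_le_one {d : ℕ} (x : EE d) (R : ℝ) (y) : cut x R y ≤ 1 := max_le zero_le_one (min_le_left _ _)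
lemma cut_eq_one {d : ℕ} (x : EE d) (R : ℝ) (y) (hy : y ∈ Metric.closedBall x R) : cut x R y = 1 := by
  rw [Metric.mem_closedBall, dist_eq_norm] at hy
  unfold cut
  rw [min_eq_left (by linarith), max_eq_right zero_le_one]
lemma cut_compact {d : ℕ} (x : EE d) (R : ℝ) : HasCompactSupport (cut x R) := by
  refine HasCompactSupport.intro (isCompact_closedBall x (R+1)) fun y hy => ?_
  rw [Metric.mem_closedBall, dist_eq_norm, not_le] at hy
  unfold cut
  rw [max_eq_left]
  exact (min_le_right _ _).trans (by linarith)

lemma SubSol.step {d : ℕ} {T c : ℝ} {u : ℝ → EE d → ℝ} (hu : SubSol T c u) (hT : 0 < T) (hc : 0 ≤ c)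
    {τ : ℝ} (hτ : 0 < τ) (x : EE d) : ∃ K : ℝ, 0 ≤ K ∧ ∀ R : ℝ, 1 ≤ R → ∃ M : ℝ, 0 ≤ M ∧
    ∀ s η τ' : ℝ, 0 ≤ s → 0 < η → s + η ≤ T → τ ≤ τ' → τ' + 2*η ≤ τ + 2*T →
    ∫ y, gk τ' (x-y) * (u (s+η) y * chi x R y) ≤
      (∫ y, gk (τ'+2*η) (x-y) * (u s y * chi x R y)) + K * η/R^2 + M * η^2 := by
  obtain ⟨C0, hC0, hint⟩ := hu.int x
  obtain ⟨Ck, hCk, hker⟩ := kernel_le (d := d) (T0 := 2*T) hτ (by positivity)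
  set L := (2:ℝ)^((d:ℝ)/2) * (1 + 32*(τ+2*T)^2) with hL
  have hL0 : 0 ≤ L := by positivity
  refine ⟨2*Ck*(L*C0), by positivity, fun R hR => ?_⟩
  have hR0 : 0 < R := by linarith
  obtain ⟨M, hM0, hM⟩ := hu.bdd x (R+1)
  refine ⟨M*c, by positivity, ?_⟩
  intro s η τ' hs hη hsη hττ' hτ'
  have hτ'0 : 0 < τ' := by linarith
  have hsT : s ∈ Icc 0 T := ⟨hs, by linarith⟩
  have hsηT : s + η ∈ Icc 0 T := ⟨by linarith, hsη⟩
  have hus := hu.cont_t hsT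
  have husη := hu.cont_t hsηT
  set f : EE d → ℝ := fun y => u s y * cut x (R+1) y with hf
  have hfc : Continuous f := hus.mul (cut_cont _ _)
  have hfs : HasCompactSupport f := (cut_compact x (R+1)).mul_left
  have hf0 : ∀ y, 0 ≤ f y := fun y => mul_nonneg (hu.nonneg _ _) (cut_nonneg _ _ _)
  have hfu : ∀ y, f y ≤ u s y := fun y => mul_le_of_le_one_right (hu.nonneg _ _) (cut_le_one _ _ _)
  have hgc := gk_cont (d := d)
  have hχc := chi_cont x R
  have hχs := chi_compact x hR0
  have hwc : Continuous (fun y => wk f η y) :=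
    (wk_cont hfc hfs).comp (f := fun y => (η, y)) (by fun_prop)
  have hg1 : Continuous (fun y => gk τ' (x - y)) := (hgc τ').comp (by fun_prop)
  have hg2 : Continuous (fun y => gk (τ'+2*η) (x - y)) := (hgc _).comp (by fun_prop)
  -- pointwise
  have hpt : ∀ y, u (s+η) y * chi x R y ≤ wk f η y * chi x R y + M*(c*η^2) := by
    intro y
    by_cases hy : y ∈ Metric.closedBall x R
    · have hb : Metric.closedBall y 1 ⊆ Metric.closedBall x (R+1) :=
        Metric.closedBall_subset_closedBall' (by rw [Metric.mem_closedBall] at hy; linarith)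
      have := hu.loc s η hs hη hsη y f hfc hfs hf0 (fun z hz => by
        simp only [hf]; rw [cut_eq_one _ _ _ (hb hz), mul_one]) M hM0 (fun t ht z hz =>
          hM t ⟨hs.trans ht.1, ht.2.trans hsη⟩ z (hb hz))
      have h2 := mul_le_mul_of_nonneg_right this (chi_nonneg x R y)
      have h3 : M*(c*η^2) * chi x R y ≤ M*(c*η^2) := mul_le_of_le_one_right (by positivity) (chi_le_one _ _ _)
      linarith
    · rw [chi_eq_zero hR0 hy]; simp; positivity
  have j1 : Integrable (fun y => gk τ' (x-y) * (u (s+η) y * chi x R y)) :=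
    (hg1.mul (husη.mul hχc)).integrable_of_hasCompactSupport (hχs.mul_left.mul_left)
  have j2 : Integrable (fun y => gk τ' (x-y) * (wk f η y * chi x R y)) :=
    (hg1.mul (hwc.mul hχc)).integrable_of_hasCompactSupport (hχs.mul_left.mul_left)
  have j3 : Integrable (fun y => gk τ' (x-y) * (M*(c*η^2))) := (gk_integrable_sub hτ'0 x).mul_const _
  have s1 : ∫ y, gk τ' (x-y) * (u (s+η) y * chi x R y) ≤
      (∫ y, gk τ' (x-y) * (wk f η y * chi x R y)) + M*(c*η^2) := by
    have : ∫ y, gk τ' (x-y) * (u (s+η) y * chi x R y) ≤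
      ∫ y, (gk τ' (x-y) * (wk f η y * chi x R y) + gk τ' (x-y) * (M*(c*η^2))) := by
      apply integral_mono j1 (j2.add j3)
      intro y
      have := mul_le_mul_of_nonneg_left (hpt y) (gk_pos hτ'0 (x-y)).le
      simp only [Pi.add_apply]
      linarith
    rw [integral_add j2 j3, integral_mul_const, gk_integral_sub hτ'0, one_mul] at this
    exact this
  -- Fubini
  have s2 : ∫ y, gk τ' (x-y) * (wk f η y * chi x R y) =
      ∫ z, f z * ∫ y, gk (2*η) (y-z) * gk τ' (x-y) * chi x R y := by
    have e1 : ∀ y, gk τ' (x-y) * (wk f η y * chi x R y) =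
        ∫ z, f z * (gk (2*η) (y-z) * gk τ' (x-y) * chi x R y) := by
      intro y
      rw [wk_eq hη, ← integral_mul_const, ← integral_const_mul]
      congr 1; funext z
      rw [gk_sub_comm (2*η) z y]; ring
    simp only [e1]
    rw [integral_integral_swap]
    · simp only [integral_const_mul]
    · apply Continuous.integrable_of_hasCompactSupport
      · have a1 : Continuous (fun p : EE d × EE d => gk (2*η) (p.1 - p.2)) := (hgc _).comp (by fun_prop)
        have a2 : Continuous (fun p : EE d × EE d => gk τ' (x - p.1)) := (hgc _).comp (by fun_prop)
        exact (hfc.comp continuous_snd).mul ((a1.mul a2).mul (hχc.comp continuous_fst))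
      · refine HasCompactSupport.intro (hχs.prod hfs) ?_
        rintro ⟨y, z⟩ hyz
        simp only [mem_prod, not_and_or] at hyz
        simp only [Function.uncurry]
        rcases hyz with h | h
        · rw [image_eq_zero_of_notMem_tsupport h]; simp
        · rw [image_eq_zero_of_notMem_tsupport h]; simp
  have hτ''0 : 0 < τ' + 2*η := by linarith
  -- kernel
  have i5 := (hint s hsT (2*(τ'+2*η)) (by positivity))
  have j4 : Integrable (fun y => gk (τ'+2*η) (x-y) * (u s y * chi x R y)) :=
    (hg2.mul (hus.mul hχc)).integrable_of_hasCompactSupport (hχs.mul_left.mul_left)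
  have s3 : ∫ z, f z * ∫ y, gk (2*η) (y-z) * gk τ' (x-y) * chi x R y ≤
      ∫ z, (gk (τ'+2*η) (x-z) * (u s z * chi x R z) +
        (Ck * (2*η/R^2) * L) * (gk (2*(τ'+2*η)) (x-z) * u s z)) := by
    apply integral_mono_of_nonneg
    · refine Filter.Eventually.of_forall fun z => mul_nonneg (hf0 z) (integral_nonneg fun y => ?_)
      exact mul_nonneg (mul_nonneg (gk_pos (by positivity) _).le (gk_pos hτ'0 _).le) (chi_nonneg _ _ _)
    · exact j4.add (i5.1.const_mul _)
    · refine Filter.Eventually.of_forall fun z => ?_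
      have k1 := hker (2*η) τ' R (by positivity) (by linarith) hττ' hR x z
      rw [add_comm (2*η) τ'] at k1
      have k0 : 0 ≤ ∫ y, gk (2*η) (y-z) * gk τ' (x-y) * chi x R y := integral_nonneg fun y =>
        mul_nonneg (mul_nonneg (gk_pos (by positivity) _).le (gk_pos hτ'0 _).le) (chi_nonneg _ _ _)
      have k2 := mul_le_mul (hfu z) k1 k0 (hu.nonneg s z)
      refine k2.trans ?_
      have k3 : (1 + ‖x-z‖^4) * gk (τ'+2*η) (x-z) ≤ L * gk (2*(τ'+2*η)) (x-z) := by
        refine (gk_poly hτ''0 (x-z)).trans ?_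
        apply mul_le_mul_of_nonneg_right _ (gk_pos (by positivity) _).le
        rw [hL]
        gcongr
      have k4 := mul_le_mul_of_nonneg_left k3 (show 0 ≤ u s z * (Ck * (2*η/R^2)) from
        mul_nonneg (hu.nonneg s z) (by positivity))
      calc _ = gk (τ'+2*η) (x-z) * (u s z * chi x R z) +
            u s z * (Ck * (2*η/R^2)) * ((1 + ‖x-z‖^4) * gk (τ'+2*η) (x-z)) := by ring
        _ ≤ gk (τ'+2*η) (x-z) * (u s z * chi x R z) + u s z * (Ck * (2*η/R^2)) * (L * gk (2*(τ'+2*η)) (x-z)) := by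
            linarith
        _ = _ := by ring
  rw [integral_add j4 (i5.1.const_mul _), integral_const_mul] at s3
  have s4 := mul_le_mul_of_nonneg_left i5.2 (show 0 ≤ Ck * (2*η/R^2) * L by positivity)
  rw [s2] at s1
  have s5 : Ck * (2*η/R^2) * L * C0 = 2*Ck*(L*C0)*η/R^2 := by ring
  have s6 : M * (c*η^2) = M*c*η^2 := by ring
  linarith

lemma SubSol.tele {d : ℕ} {T c : ℝ} {u : ℝ → EE d → ℝ} (hu : SubSol T c u) (hT : 0 < T) (hc : 0 ≤ c)
    {τ : ℝ} (hτ : 0 < τ) (x : EE d) {s : ℝ} (hs : 0 < s) (hsT : s ≤ T) :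
    ∫ y, gk τ (x-y) * u s y ≤ ∫ y, gk (τ+2*s) (x-y) * u 0 y := by
  obtain ⟨K, hK, hstep⟩ := hu.step hT hc hτ x
  obtain ⟨C0, hC0, hint⟩ := hu.int x
  set I := ∫ y, gk (τ+2*s) (x-y) * u 0 y with hI
  have h0T : (0:ℝ) ∈ Icc 0 T := ⟨le_rfl, hT.le⟩
  have hsT' : s ∈ Icc 0 T := ⟨hs.le, hsT⟩
  have hR : ∀ R : ℝ, 1 ≤ R → ∫ y, gk τ (x-y) * (u s y * chi x R y) ≤ I + K*s/R^2 := by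
    intro R hR
    have hR0 : 0 < R := by linarith
    obtain ⟨M, hM, hst⟩ := hstep R hR
    have hN : ∀ N : ℕ, 0 < N → ∫ y, gk τ (x-y) * (u s y * chi x R y) ≤ I + K*s/R^2 + M*s^2/N := by
      intro N hN
      have hN' : (0:ℝ) < N := by exact_mod_cast hN
      set η := s/N with hη
      have hη0 : 0 < η := by positivity
      have hNη : N * η = s := by rw [hη]; field_simp
      have ind : ∀ k : ℕ, k ≤ N → ∫ y, gk (τ + 2*(s - k*η)) (x-y) * (u (k*η) y * chi x R y) ≤
          I + k * (K*η/R^2 + M*η^2) := by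
        intro k
        induction k with
        | zero =>
          intro _
          simp only [Nat.cast_zero, zero_mul, sub_zero, add_zero]
          rw [hI]
          apply integral_mono_of_nonneg
          · exact Filter.Eventually.of_forall fun y =>
              mul_nonneg (gk_pos (by positivity) _).le (mul_nonneg (hu.nonneg _ _) (chi_nonneg _ _ _))
          · exact (hint 0 h0T _ (by positivity)).1
          · refine Filter.Eventually.of_forall fun y => ?_
            exact mul_le_mul_of_nonneg_left (mul_le_of_le_one_right (hu.nonneg _ _) (chi_le_one _ _ _)) (gk_pos (by positivity) _).le
        | succ k ih =>
          intro hk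
          have ih' := ih (by omega)
          have hk' : ((k:ℝ)+1) * η ≤ s := by
            rw [← hNη]
            gcongr
            exact_mod_cast hk
          have h1 := hst (k*η) η (τ + 2*(s - (k+1)*η)) (by positivity) hη0 (by linarith) (by linarith)
            (by nlinarith [show 0 ≤ (k:ℝ)*η by positivity])
          rw [show τ + 2*(s - (k+1)*η) + 2*η = τ + 2*(s-k*η) by ring, show k*η+η = (k+1)*η by ring] at h1
          push_cast
          linarith
      have := ind N le_rfl
      rw [hNη, sub_self, mul_zero, add_zero] at this
      refine this.trans (le_of_eq ?_)
      rw [hη]; field_simp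
      ring
    have hlim : Filter.Tendsto (fun N : ℕ => I + K*s/R^2 + M*s^2/N) Filter.atTop (nhds (I + K*s/R^2 + 0)) :=
      (tendsto_const_div_atTop_nhds_zero_nat (M*s^2)).const_add _
    rw [add_zero] at hlim
    refine ge_of_tendsto hlim ?_
    filter_upwards [Filter.eventually_gt_atTop 0] with N hN' using hN N hN'
  -- R to infinity
  have hl : Filter.Tendsto (fun n : ℕ => ∫ y, gk τ (x-y) * (u s y * chi x n y)) Filter.atTop
      (nhds (∫ y, gk τ (x-y) * u s y)) := by
    have hg1 : Continuous (fun y => gk τ (x - y)) := (gk_cont τ).comp (by fun_prop)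
    refine tendsto_integral_of_dominated_convergence (fun y => gk τ (x-y) * u s y) ?_ ?_ ?_ ?_
    · intro n
      exact (hg1.mul ((hu.cont_t hsT').mul (chi_cont _ _))).aestronglyMeasurable
    · exact (hint s hsT' τ hτ).1
    · intro n
      refine Filter.Eventually.of_forall fun y => ?_
      rw [Real.norm_of_nonneg (mul_nonneg (gk_pos hτ _).le (mul_nonneg (hu.nonneg _ _) (chi_nonneg _ _ _)))]
      exact mul_le_mul_of_nonneg_left (mul_le_of_le_one_right (hu.nonneg _ _) (chi_le_one _ _ _)) (gk_pos hτ _).le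
    · refine Filter.Eventually.of_forall fun y => ?_
      have h1 : Filter.Tendsto (fun n : ℕ => chi x n y) Filter.atTop (nhds 1) := by
        unfold chi
        have h2 : Filter.Tendsto (fun n : ℕ => ‖y-x‖^2/(n:ℝ)^2) Filter.atTop (nhds 0) :=
          tendsto_const_nhds.div_atTop ((Filter.tendsto_pow_atTop two_ne_zero).comp tendsto_natCast_atTop_atTop)
        have h3 := (((h2.const_sub 1).max (tendsto_const_nhds (x := (0:ℝ)))).pow 2)
        simpa using h3
      have := (h1.const_mul (u s y)).const_mul (gk τ (x-y))
      simpa using this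
  have hr : Filter.Tendsto (fun n : ℕ => I + K*s/(n:ℝ)^2) Filter.atTop (nhds (I + 0)) :=
    (tendsto_const_nhds.div_atTop ((Filter.tendsto_pow_atTop two_ne_zero).comp tendsto_natCast_atTop_atTop)).const_add _
  rw [add_zero] at hr
  refine le_of_tendsto_of_tendsto hl hr ?_
  filter_upwards [Filter.eventually_ge_atTop 1] with n hn
  exact hR n (by exact_mod_cast hn)

lemma SubSol.pt {d : ℕ} {T c : ℝ} {u : ℝ → EE d → ℝ} (hu : SubSol T c u) (hT : 0 < T) (hc : 0 ≤ c)
    (x : EE d) {t : ℝ} (ht : 0 < t) (htT : t ≤ T) :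
    u t x ≤ ∫ y, gk (2*t) (x-y) * u 0 y := by
  obtain ⟨M, hM0, hM⟩ := hu.bdd x 1
  obtain ⟨C0, hC0, hint⟩ := hu.int x
  have main : ∀ η : ℝ, 0 < η → η < t → u t x ≤ (∫ y, gk (2*t) (x-y) * u 0 y) + M*(c*η^2) := by
    intro η hη hηt
    have hsT : t - η ∈ Icc 0 T := ⟨by linarith, by linarith⟩
    have h1 := hu.loc (t-η) η (by linarith) hη (by linarith) x (fun y => u (t-η) y * cut x 1 y)
      ((hu.cont_t hsT).mul (cut_cont _ _)) (cut_compact x 1).mul_left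
      (fun y => mul_nonneg (hu.nonneg _ _) (cut_nonneg _ _ _))
      (fun y hy => by rw [cut_eq_one _ _ _ hy, mul_one]) M hM0
      (fun r hr y hy => hM r ⟨by linarith [hr.1], by linarith [hr.2]⟩ y hy)
    rw [sub_add_cancel, wk_eq hη] at h1
    have h2 : ∫ y, gk (2*η) (y-x) * (u (t-η) y * cut x 1 y) ≤ ∫ y, gk (2*η) (x-y) * u (t-η) y := by
      apply integral_mono_of_nonneg
      · exact Filter.Eventually.of_forall fun y =>
          mul_nonneg (gk_pos (by positivity) _).le (mul_nonneg (hu.nonneg _ _) (cut_nonneg _ _ _))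
      · exact (hint _ hsT _ (by positivity)).1
      · refine Filter.Eventually.of_forall fun y => ?_
        simp only []
        rw [gk_sub_comm]
        exact mul_le_mul_of_nonneg_left (mul_le_of_le_one_right (hu.nonneg _ _) (cut_le_one _ _ _)) (gk_pos (by positivity) _).le
    have h3 := hu.tele hT hc (τ := 2*η) (by positivity) x (s := t-η) (by linarith) (by linarith)
    rw [show 2*η + 2*(t-η) = 2*t by ring] at h3
    linarith
  have hlim : Filter.Tendsto (fun η : ℝ => (∫ y, gk (2*t) (x-y) * u 0 y) + M*(c*η^2)) (nhdsWithin 0 (Ioi 0))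
      (nhds ((∫ y, gk (2*t) (x-y) * u 0 y) + M*(c*0^2))) :=
    ((by fun_prop : Continuous (fun η : ℝ => (∫ y, gk (2*t) (x-y) * u 0 y) + M*(c*η^2))).tendsto 0).mono_left
      nhdsWithin_le_nhds
  have := ge_of_tendsto hlim (b := u t x) (by
    filter_upwards [Ioo_mem_nhdsGT ht] with η hη using main η hη.1 hη.2)
  simpa using this


lemma gk_lint {d : ℕ} {τ : ℝ} (hτ : 0 < τ) (x : EE d) :
    ∫⁻ y, ENNReal.ofReal (gk τ (x - y)) = 1 := by
  rw [← ofReal_integral_eq_lintegral_ofReal (gk_integrable_sub hτ x)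
    (Filter.Eventually.of_forall fun z => (gk_pos hτ _).le), gk_integral_sub hτ]
  simp

lemma gk_lint' {d : ℕ} {τ : ℝ} (hτ : 0 < τ) (x : EE d) :
    ∫⁻ y, ENNReal.ofReal (gk τ (y - x)) = 1 := by
  simp_rw [gk_sub_comm τ _ x]; exact gk_lint hτ x

lemma fstar_le_of {d : ℕ} {f : EE d → ℝ} (hf : ∀ y, 0 ≤ f y) {x : EE d} {C : ℝ≥0∞}
    (h : ∀ τ, 0 < τ → ∫⁻ y, ENNReal.ofReal (gk τ (x-y)) * ENNReal.ofReal (f y) ≤ C) :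
    fstar f x ≤ C := by
  unfold fstar
  refine iSup₂_le fun τ hτ => ?_
  refine le_trans (le_of_eq ?_) (h τ hτ)
  congr 1; ext y
  rw [← ENNReal.ofReal_mul (gk_pos hτ _).le, abs_of_nonneg (hf y)]; rfl

lemma le_fstar {d : ℕ} {f : EE d → ℝ} (hf : ∀ y, 0 ≤ f y) (x : EE d) {τ : ℝ} (hτ : 0 < τ) :
    ∫⁻ y, ENNReal.ofReal (gk τ (x-y)) * ENNReal.ofReal (f y) ≤ fstar f x := by
  unfold fstar
  refine le_trans (le_of_eq ?_) (le_iSup₂ (f := fun (τ : ℝ) (_ : τ ∈ Ioi (0:ℝ)) => ∫⁻ y, ENNReal.ofReal ((2 * π * τ) ^ (-(d:ℝ)/2) * Real.exp (-‖x - y‖^2 / (2 * τ)) * |f y|)) τ hτ)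
  congr 1; ext y
  rw [← ENNReal.ofReal_mul (gk_pos hτ _).le, abs_of_nonneg (hf y)]; rfl

lemma jensen {d : ℕ} {τ : ℝ} (hτ : 0 < τ) (x : EE d) {f : EE d → ℝ} (hf : Measurable f)
    (hf0 : ∀ y, 0 ≤ f y) {a : ℝ} (ha : 1 ≤ a) :
    (∫⁻ y, ENNReal.ofReal (gk τ (x-y)) * ENNReal.ofReal (f y)) ^ a ≤
      ∫⁻ y, ENNReal.ofReal (gk τ (x-y)) * ENNReal.ofReal (f y) ^ a := by
  have hm : Measurable (fun y => ENNReal.ofReal (gk τ (x-y))) :=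
    ENNReal.measurable_ofReal.comp ((gk_cont τ).comp (continuous_const.sub continuous_id)).measurable
  set μ : Measure (EE d) := volume.withDensity (fun y => ENNReal.ofReal (gk τ (x-y))) with hμ
  have hp : IsProbabilityMeasure μ := ⟨by
    rw [hμ, withDensity_apply _ MeasurableSet.univ, Measure.restrict_univ, gk_lint hτ]⟩
  have key := eLpNorm'_le_eLpNorm'_of_exponent_le (μ := μ) one_pos ha hf.aestronglyMeasurable
  have e : ∀ y, ‖f y‖ₑ = ENNReal.ofReal (f y) := fun y => Real.enorm_of_nonneg (hf0 y)
  have h1 : Measurable fun y => ENNReal.ofReal (f y) := ENNReal.measurable_ofReal.comp hf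
  simp only [eLpNorm', e, ENNReal.rpow_one, div_one] at key
  rw [hμ, lintegral_withDensity_eq_lintegral_mul _ hm h1,
    lintegral_withDensity_eq_lintegral_mul _ hm (h1.pow_const a)] at key
  have := ENNReal.rpow_le_rpow key (by linarith : 0 ≤ a)
  rw [← ENNReal.rpow_mul, one_div, inv_mul_cancel₀ (by linarith), ENNReal.rpow_one] at this
  exact this

lemma semig {d : ℕ} {τ s : ℝ} (hτ : 0 < τ) (hs : 0 < s) (x : EE d) {F : EE d → ℝ≥0∞}
    (hF : Measurable F) :
    ∫⁻ y, ENNReal.ofReal (gk τ (x-y)) * ∫⁻ z, ENNReal.ofReal (gk s (y-z)) * F z =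
      ∫⁻ z, ENNReal.ofReal (gk (s+τ) (x-z)) * F z := by
  have g2 : ∀ r : ℝ, Measurable (fun p : EE d × EE d => ENNReal.ofReal (gk r (p.1 - p.2))) := fun r =>
    ENNReal.measurable_ofReal.comp ((gk_cont r).comp (continuous_fst.sub continuous_snd)).measurable
  have g1 : ∀ r : ℝ, Measurable (fun y : EE d => ENNReal.ofReal (gk r (x - y))) := fun r =>
    ENNReal.measurable_ofReal.comp ((gk_cont r).comp (continuous_const.sub continuous_id)).measurable
  have g1' : ∀ (r : ℝ) (w : EE d), Measurable (fun y : EE d => ENNReal.ofReal (gk r (y - w))) := fun r w =>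
    ENNReal.measurable_ofReal.comp ((gk_cont r).comp (continuous_id.sub continuous_const)).measurable
  have e1 : ∀ y, ENNReal.ofReal (gk τ (x-y)) * ∫⁻ z, ENNReal.ofReal (gk s (y-z)) * F z =
      ∫⁻ z, ENNReal.ofReal (gk τ (x-y)) * (ENNReal.ofReal (gk s (y-z)) * F z) := fun y => by
    rw [lintegral_const_mul]
    exact ((g2 s).comp (measurable_const.prodMk measurable_id)).mul hF
  simp_rw [e1]
  rw [lintegral_lintegral_swap]
  · congr 1; ext z
    have e2 : ∀ y, ENNReal.ofReal (gk τ (x-y)) * (ENNReal.ofReal (gk s (y-z)) * F z) =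
        (ENNReal.ofReal (gk (s+τ) (x-z)) * F z) *
          ENNReal.ofReal (gk (s*τ/(s+τ)) (y - (z + (s/(s+τ)) • (x - z)))) := fun y => by
      rw [← mul_assoc, ← ENNReal.ofReal_mul (gk_pos hτ _).le, mul_comm (gk τ (x-y)), gk_prod hs hτ,
        ENNReal.ofReal_mul (gk_pos (by positivity) _).le]
      ring
    simp_rw [e2]
    rw [lintegral_const_mul _ (g1' _ _), gk_lint' (by positivity), mul_one]
  · refine Measurable.aemeasurable ?_
    exact ((g1 τ).comp measurable_fst).mul ((g2 s).mul (hF.comp measurable_snd))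

lemma mk_sub {d : ℕ}
    {V : EE d → ℝ} {W : ℝ → ℝ} (hV : IsDepositionRate d V W)
    {lam T : ℝ} (hlam : 0 < lam)
    {h : ℝ → EE d → ℝ}
    (hcont : ContinuousOn (fun p : ℝ × EE d => h p.1 p.2) (Set.Icc 0 T ×ˢ Set.univ))
    (hspace : ∀ t ∈ Set.Ioc (0:ℝ) T, ContDiff ℝ 2 (h t))
    (htime : ∀ (x : EE d), ∀ t ∈ Set.Ioc (0:ℝ) T, DifferentiableAt ℝ (fun s => h s x) t)
    (hpde : ∀ t ∈ Set.Ioc (0:ℝ) T, ∀ x,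
      deriv (fun s => h s x) t = lapl (h t) x + lam * V (gradient (h t) x))
    (hstar : ∀ x,
      (⨆ t ∈ Set.Icc (0:ℝ) T, fstar (fun y => Real.exp (2 * lam * |h t y|)) x) < ⊤) :
    SubSol T (d*(4*d+8)) (fun t y => rexp (lam * |h t y|)) := by
  have hc : ContinuousOn (fun p : ℝ × EE d => rexp (lam * |h p.1 p.2|)) (Icc 0 T ×ˢ univ) :=
    Real.continuous_exp.comp_continuousOn (continuousOn_const.mul hcont.abs)
  refine ⟨hc, fun t y => (Real.exp_pos _).le, ?_, ?_⟩
  · intro s η hs hη hsT x0 f hf hfc hf0 hfv M hM0 hM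
    obtain ⟨σ, hσ, hσx, hle⟩ : ∃ σ : ℝ, (σ = 1 ∨ σ = -1) ∧ |h (s+η) x0| = σ * h (s+η) x0 ∧
        ∀ r : ℝ, σ * r ≤ |r| := by
      rcases abs_choice (h (s+η) x0) with h1 | h1
      · exact ⟨1, Or.inl rfl, by rw [h1, one_mul], fun r => by rw [one_mul]; exact le_abs_self r⟩
      · exact ⟨-1, Or.inr rfl, by rw [h1]; ring, fun r => by
          rw [neg_one_mul]; exact neg_le_abs r⟩
    have hvu : ∀ t y, rexp (σ * lam * h t y) ≤ rexp (lam * |h t y|) := fun t y => by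
      apply Real.exp_le_exp.2
      have := mul_le_mul_of_nonneg_left (hle (h t y)) hlam.le
      linarith [this]
    have := local_le (v := fun t x => rexp (σ * lam * h t x)) hη x0
      (Real.continuous_exp.comp_continuousOn (continuousOn_const.mul
        (hcont.mono (prod_mono (Icc_subset_Icc hs hsT) (subset_univ _)))))
      (fun t ht x => sub_HD hV hlam hσ (hspace t ⟨by linarith [ht.1], by linarith [ht.2]⟩)
        (htime x t ⟨by linarith [ht.1], by linarith [ht.2]⟩)
        (hpde t ⟨by linarith [ht.1], by linarith [ht.2]⟩ x))
      hf hfc hf0 (fun y hy => (hvu s y).trans (hfv y hy)) hM0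
      (fun t ht y hy => (hvu t y).trans (hM t ht y hy))
    have e : lam * |h (s+η) x0| = σ * lam * h (s+η) x0 := by rw [hσx]; ring
    simp only [e]
    exact this
  · intro x
    set S := ⨆ t ∈ Set.Icc (0:ℝ) T, fstar (fun y => Real.exp (2 * lam * |h t y|)) x with hS
    refine ⟨S.toReal, ENNReal.toReal_nonneg, fun t ht τ hτ => ?_⟩
    have hct : Continuous (fun y => rexp (lam * |h t y|)) := by
      have : ContinuousOn (fun y : EE d => (t, y)) univ := by fun_prop
      exact continuousOn_univ.1 (hc.comp this (fun y _ => ⟨ht, mem_univ _⟩))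
    have hcg : Continuous (fun y => gk τ (x-y) * rexp (lam * |h t y|)) :=
      ((gk_cont τ).comp (continuous_const.sub continuous_id)).mul hct
    have h0 : ∀ y, 0 ≤ gk τ (x-y) * rexp (lam * |h t y|) := fun y =>
      mul_nonneg (gk_pos hτ _).le (Real.exp_pos _).le
    have hb : ∫⁻ y, ENNReal.ofReal (gk τ (x-y) * rexp (lam * |h t y|)) ≤ S := by
      calc _ ≤ ∫⁻ y, ENNReal.ofReal (gk τ (x-y)) * ENNReal.ofReal (rexp (2 * lam * |h t y|)) := by
            refine lintegral_mono fun y => ?_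
            simp only
            rw [ENNReal.ofReal_mul (gk_pos hτ _).le]
            refine mul_le_mul_right (ENNReal.ofReal_le_ofReal (Real.exp_le_exp.2 ?_)) _
            have := mul_nonneg hlam.le (abs_nonneg (h t y))
            linarith
        _ ≤ fstar (fun y => Real.exp (2 * lam * |h t y|)) x :=
            le_fstar (fun y => (Real.exp_pos _).le) x hτ
        _ ≤ S := le_iSup₂ (f := fun t (_ : t ∈ Icc (0:ℝ) T) =>
            fstar (fun y => Real.exp (2 * lam * |h t y|)) x) t ht
    have hi : Integrable (fun y => gk τ (x-y) * rexp (lam * |h t y|)) := by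
      refine ⟨hcg.aestronglyMeasurable, ?_⟩
      rw [hasFiniteIntegral_iff_ofReal (Filter.Eventually.of_forall h0)]
      exact hb.trans_lt (hstar x)
    refine ⟨hi, ?_⟩
    rw [integral_eq_lintegral_of_nonneg_ae (Filter.Eventually.of_forall h0) hcg.aestronglyMeasurable]
    exact ENNReal.toReal_mono (hstar x).ne hb

/-- If `h` is a classical solution of `∂ₜh = Δh + λV(∇h)` on `[0,T]` with
`h(0,·) = h₀` and `sup_{t∈[0,T]} (e^{2λ|h(t,·)|})*(x) < ∞` for every `x`, then for every
`a ≥ 1`, `t ∈ [0,T]` and `x`, `(e^{aλ|h(t,·)|})*(x) ≤ (e^{aλ|h₀|})*(x)`; in particular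
`|h(t,x)| ≤ (1/λ) ln((e^{λ|h₀|})*(x))`. -/
theorem statement16 {d : ℕ} (hd : 1 ≤ d)
    (V : EuclideanSpace ℝ (Fin d) → ℝ) (W : ℝ → ℝ) (hV : IsDepositionRate d V W)
    (lam T : ℝ) (hlam : 0 < lam) (hT : 0 < T)
    (h₀ : EuclideanSpace ℝ (Fin d) → ℝ) (h : ℝ → EuclideanSpace ℝ (Fin d) → ℝ)
    (hcont : ContinuousOn (fun p : ℝ × EuclideanSpace ℝ (Fin d) => h p.1 p.2)
      (Set.Icc 0 T ×ˢ Set.univ))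
    (hspace : ∀ t ∈ Set.Ioc (0:ℝ) T, ContDiff ℝ 2 (h t))
    (htime : ∀ (x : EuclideanSpace ℝ (Fin d)), ∀ t ∈ Set.Ioc (0:ℝ) T,
      DifferentiableAt ℝ (fun s => h s x) t)
    (hpde : ∀ t ∈ Set.Ioc (0:ℝ) T, ∀ x,
      deriv (fun s => h s x) t = lapl (h t) x + lam * V (gradient (h t) x))
    (hinit : ∀ x, h 0 x = h₀ x)
    (hstar : ∀ x,
      (⨆ t ∈ Set.Icc (0:ℝ) T, fstar (fun y => Real.exp (2 * lam * |h t y|)) x) < ⊤) :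
    ∀ a : ℝ, 1 ≤ a → ∀ t ∈ Set.Icc (0:ℝ) T, ∀ x,
      fstar (fun y => Real.exp (a * lam * |h t y|)) x ≤
        fstar (fun y => Real.exp (a * lam * |h₀ y|)) x ∧
      |h t x| ≤ (1 / lam) *
        Real.log ((fstar (fun y => Real.exp (lam * |h₀ y|)) x).toReal) := by
  have hu := mk_sub hV hlam hcont hspace htime hpde hstar
  obtain rfl : h 0 = h₀ := funext hinit
  have h00 : (0:ℝ) ∈ Icc (0:ℝ) T := ⟨le_rfl, hT.le⟩
  have hu0 : Continuous (fun y => rexp (lam * |h 0 y|)) := hu.cont_t h00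
  have pos0 : ∀ y, 0 ≤ rexp (lam * |h 0 y|) := fun y => (Real.exp_pos _).le
  have pt : ∀ t ∈ Ioc (0:ℝ) T, ∀ x, ENNReal.ofReal (rexp (lam * |h t x|)) ≤
      ∫⁻ y, ENNReal.ofReal (gk (2*t) (x-y)) * ENNReal.ofReal (rexp (lam * |h 0 y|)) := by
    intro t ht x
    have h2t : 0 < 2*t := by linarith [ht.1]
    have h1 := hu.pt hT (by positivity) x ht.1 ht.2
    obtain ⟨C, _, hC⟩ := hu.int x
    have hi := (hC 0 h00 (2*t) h2t).1
    have := ENNReal.ofReal_le_ofReal h1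
    rw [ofReal_integral_eq_lintegral_ofReal hi (Filter.Eventually.of_forall fun y =>
      mul_nonneg (gk_pos h2t _).le (pos0 y))] at this
    simp_rw [ENNReal.ofReal_mul (gk_pos h2t _).le] at this
    exact this
  have epow : ∀ a t y, ENNReal.ofReal (rexp (a * lam * |h t y|)) =
      ENNReal.ofReal (rexp (lam * |h t y|)) ^ a := fun a t y => by
    rw [ENNReal.ofReal_rpow_of_pos (Real.exp_pos _), ← Real.exp_mul]
    congr 2; ring
  have hfin : ∀ x, fstar (fun y => Real.exp (lam * |h 0 y|)) x < ⊤ := fun x => by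
    refine lt_of_le_of_lt ?_ (hstar x)
    refine le_trans ?_ (le_iSup₂ (f := fun t (_ : t ∈ Icc (0:ℝ) T) =>
            fstar (fun y => Real.exp (2 * lam * |h t y|)) x) 0 h00)
    refine fstar_le_of pos0 fun τ hτ => ?_
    refine le_trans (lintegral_mono fun y => ?_) (le_fstar (fun y => (Real.exp_pos _).le) x hτ)
    refine mul_le_mul_right (ENNReal.ofReal_le_ofReal (Real.exp_le_exp.2 ?_)) _
    have := mul_nonneg hlam.le (abs_nonneg (h 0 y))
    linarith
  have bound : ∀ t ∈ Ioc (0:ℝ) T, ∀ x, |h t x| ≤ (1 / lam) *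
        Real.log ((fstar (fun y => Real.exp (lam * |h 0 y|)) x).toReal) := by
    intro t ht x
    have h2t : 0 < 2*t := by linarith [ht.1]
    have h1 := (pt t ht x).trans (le_fstar pos0 x h2t)
    have h2 := ENNReal.toReal_mono (hfin x).ne h1
    rw [ENNReal.toReal_ofReal (Real.exp_pos _).le] at h2
    have h3 := Real.log_le_log (Real.exp_pos _) h2
    rw [Real.log_exp] at h3
    rw [one_div, inv_mul_eq_div, le_div_iff₀ hlam]
    linarith
  intro a ha t ht x
  rcases ht.1.eq_or_lt with h0t | h0t
  · subst h0t
    refine ⟨le_rfl, ?_⟩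
    have hc : ContinuousOn (fun s => |h s x|) (Icc 0 T) := by
      have : ContinuousOn (fun s : ℝ => (s, x)) (Icc 0 T) := by fun_prop
      exact (hcont.comp this (fun y hy => ⟨hy, mem_univ _⟩)).abs
    have hlim : Filter.Tendsto (fun s => |h s x|) (nhdsWithin 0 (Ioc 0 T)) (nhds |h 0 x|) :=
      (hc 0 h00).mono_left (nhdsWithin_mono _ Ioc_subset_Icc_self)
    have hne : (nhdsWithin (0:ℝ) (Ioc 0 T)).NeBot := by
      rw [nhdsWithin_Ioc_eq_nhdsGT hT]; infer_instance
    exact le_of_tendsto hlim (Filter.eventually_of_mem self_mem_nhdsWithin fun s hs => bound s hs x)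
  · have ht' : t ∈ Ioc 0 T := ⟨h0t, ht.2⟩
    have h2t : 0 < 2*t := by linarith
    refine ⟨?_, bound t ht' x⟩
    refine fstar_le_of (fun y => (Real.exp_pos _).le) fun τ hτ => ?_
    have hF : Measurable (fun z => ENNReal.ofReal (rexp (a * lam * |h 0 z|))) := by
      simp_rw [epow]
      exact (ENNReal.measurable_ofReal.comp hu0.measurable).pow_const a
    refine le_trans ?_ ((semig hτ h2t x hF).le.trans
      (le_fstar (fun y => (Real.exp_pos _).le) x (by positivity : 0 < 2*t + τ)))
    refine lintegral_mono fun y => mul_le_mul_right ?_ _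
    simp_rw [epow]
    exact (ENNReal.rpow_le_rpow (pt t ht' y) (by linarith)).trans
      (jensen h2t y hu0.measurable pos0 ha)
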